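/- (Square root cancellation for exponential sums over the circle) There exist absolute constants C > 0 and δ₀ > 0 such that for every δ ∈ (0, δ₀) there exists a real number L with δ^{−3} ≤ L ≤ δ^{−3} · exp(C (log(1/δ))^{log₃ 2}) such that for every real p with 4 < p < 6, every finite set A ⊂ S¹ := {x ∈ ℝ² : |x| = 1} whose points are pairwise separated by Euclidean distance at least δ, and every axis-parallel square B ⊂ ℝ² of side length L, one has ( |B|^{−1} ∫_B | Σ_{a ∈ A} e^{2πi a·z} |^p dz )^{1/p} ≤ exp( C (log(1/δ))^{1 − σ_p} (log log(1/δ))^{C} ) · |A|^{1/2}, where σ_p := (1/4)(1 − log₂((p−2)/2)) and a·z denotes the Euclidean inner product on ℝ². -/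

import Mathlib

open MeasureTheory

noncomputable section

/-- The weight `w_B` attached to the axis-parallel square of center `c` and side length `R`:
`w_B(x) = (1 + |x - c|/R)^(-100)` with `|·|` the Euclidean norm on `ℝ²`. -/
def wB (c : ℝ × ℝ) (R : ℝ) (x : ℝ × ℝ) : ℝ :=
  (1 + Real.sqrt ((x.1 - c.1) ^ 2 + (x.2 - c.2) ^ 2) / R) ^ (-100 : ℤ)

/-- The product weight `w̃_B(x) = (1 + |x₁ - c₁|/R)^(-100) * (1 + |x₂ - c₂|/R)^(-100)`. -/
def wtB (c : ℝ × ℝ) (R : ℝ) (x : ℝ × ℝ) : ℝ :=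
  (1 + |x.1 - c.1| / R) ^ (-100 : ℤ) * (1 + |x.2 - c.2| / R) ^ (-100 : ℤ)

/-- The axis-parallel square `B(c, R)` with center `c` and side length `R`, as a subset of `ℝ²`. -/
def sqr (c : ℝ × ℝ) (R : ℝ) : Set (ℝ × ℝ) :=
  Set.Icc (c.1 - R / 2) (c.1 + R / 2) ×ˢ Set.Icc (c.2 - R / 2) (c.2 + R / 2)

/-- The extension operator associated to the parabola, over the interval `[a, b]`:
`(E_{[a,b]} g)(x) = ∫_{[a,b]} g(ξ) e(ξ x₁ + ξ² x₂) dξ`. -/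
def extOp (a b : ℝ) (g : ℝ → ℂ) (x : ℝ × ℝ) : ℂ :=
  ∫ ξ in Set.Icc a b,
    g ξ * Complex.exp (2 * Real.pi * Complex.I * ((ξ * x.1 + ξ ^ 2 * x.2 : ℝ) : ℂ))

/-- Weighted `L^p` norm `‖f‖_{L^p(w)} = (∫_{ℝ²} |f|^p w)^{1/p}`. -/
def wLp (p : ℝ) (w : ℝ × ℝ → ℝ) (f : ℝ × ℝ → ℂ) : ℝ :=
  (∫ x : ℝ × ℝ, ‖f x‖ ^ p * w x) ^ (1 / p)

/-- `L^p` norm over the square of center `c` and side `R`. -/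
def sqLp (p : ℝ) (c : ℝ × ℝ) (R : ℝ) (f : ℝ × ℝ → ℂ) : ℝ :=
  (∫ x in sqr c R, ‖f x‖ ^ p) ^ (1 / p)

/-- Normalized weighted `L^p` norm `‖f‖_{L^p_#(w)} = (|B|⁻¹ ∫_{ℝ²} |f|^p w)^{1/p}` where the
normalizing square has side length `R` (so `|B| = R²`). -/
def shLp (p R : ℝ) (w : ℝ × ℝ → ℝ) (f : ℝ × ℝ → ℂ) : ℝ :=
  ((R ^ 2)⁻¹ * ∫ x : ℝ × ℝ, ‖f x‖ ^ p * w x) ^ (1 / p)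

/-- Normalized `L^p` norm over the square of center `c` and side `R`:
`‖f‖_{L^p_#(B)} = (|B|⁻¹ ∫_B |f|^p)^{1/p}`. -/
def shLpSq (p : ℝ) (c : ℝ × ℝ) (R : ℝ) (f : ℝ × ℝ → ℂ) : ℝ :=
  ((R ^ 2)⁻¹ * ∫ x in sqr c R, ‖f x‖ ^ p) ^ (1 / p)

/-- `DecIneq p n D` says that the constant `D` is admissible in the `l²L^p` decoupling
inequality for the parabola at scale `δ = 1/n`: for every integrable `g : [0,1] → ℂ` and every
axis-parallel square `B` of side length `δ⁻² = n²`,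
`‖E_{[0,1]} g‖_{L^p(B)} ≤ D (Σ_{J ∈ P_δ([0,1])} ‖E_J g‖_{L^p(w_B)}²)^{1/2}`. -/
def DecIneq (p : ℝ) (n : ℕ) (D : ℝ) : Prop :=
  ∀ g : ℝ → ℂ, IntegrableOn g (Set.Icc 0 1) → ∀ c : ℝ × ℝ,
    sqLp p c ((n : ℝ) ^ 2) (extOp 0 1 g) ≤
      D * (∑ k ∈ Finset.range n,
        wLp p (wB c ((n : ℝ) ^ 2)) (extOp ((k : ℝ) / (n : ℝ)) (((k : ℝ) + 1) / (n : ℝ)) g) ^ 2)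
        ^ (1 / 2 : ℝ)

/-- The decoupling constant `D_p(δ)` for the parabola at scale `δ = 1/n`, i.e. the smallest
admissible constant in the decoupling inequality. -/
def Dconst (p : ℝ) (n : ℕ) : ℝ := sInf {D : ℝ | 0 ≤ D ∧ DecIneq p n D}

/-- Center of the `(i,j)` square in the partition of the axis-parallel square of center `c` and
side length `Rb` into axis-parallel squares of side length `r`. -/
def subCtr (c : ℝ × ℝ) (Rb r : ℝ) (i j : ℕ) : ℝ × ℝ :=
  (c.1 - Rb / 2 + ((i : ℝ) + 1 / 2) * r, c.2 - Rb / 2 + ((j : ℝ) + 1 / 2) * r)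

/-- `BilIneq p n k b M` says `M` is admissible in the bilinear decoupling inequality with
`δ = 1/n`, `ν = 1/k`: for every square `B` of side `δ⁻² = n²`, every integrable `g`, and all
`ν`-separated intervals `I = [i/k, (i+1)/k]`, `I' = [i'/k, (i'+1)/k]` of the partition
`P_ν([0,1])`,
`Avg_{Δ ∈ P_{ν^{-b}}(B)} Π (Σ_{J ∈ P_{ν^b}} ‖E_J g‖_{L²_#(w̃_Δ)}²)^{p/4}
  ≤ M^p Π (Σ_{J ∈ P_δ} ‖E_J g‖_{L^p_#(w_B)}²)^{p/4}`. -/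
def BilIneq (p : ℝ) (n k b : ℕ) (M : ℝ) : Prop :=
  ∀ g : ℝ → ℂ, IntegrableOn g (Set.Icc 0 1) → ∀ c : ℝ × ℝ,
    ∀ i i' : ℕ, i < k → i' < k → (i + 1 < i' ∨ i' + 1 < i) →
    (((n ^ 2 / k ^ b : ℕ) : ℝ) ^ 2)⁻¹ *
        ∑ a ∈ Finset.range (n ^ 2 / k ^ b), ∑ a' ∈ Finset.range (n ^ 2 / k ^ b),
          ((∑ J ∈ Finset.range (k ^ (b - 1)),
              shLp 2 ((k : ℝ) ^ b)
                (wtB (subCtr c ((n : ℝ) ^ 2) ((k : ℝ) ^ b) a a') ((k : ℝ) ^ b))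
                (extOp ((i : ℝ) / (k : ℝ) + (J : ℝ) / (k : ℝ) ^ b)
                  ((i : ℝ) / (k : ℝ) + ((J : ℝ) + 1) / (k : ℝ) ^ b) g) ^ 2) ^ (p / 4) *
            (∑ J ∈ Finset.range (k ^ (b - 1)),
              shLp 2 ((k : ℝ) ^ b)
                (wtB (subCtr c ((n : ℝ) ^ 2) ((k : ℝ) ^ b) a a') ((k : ℝ) ^ b))
                (extOp ((i' : ℝ) / (k : ℝ) + (J : ℝ) / (k : ℝ) ^ b)
                  ((i' : ℝ) / (k : ℝ) + ((J : ℝ) + 1) / (k : ℝ) ^ b) g) ^ 2) ^ (p / 4))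
      ≤ M ^ p *
        ((∑ J ∈ Finset.range (n / k),
            shLp p ((n : ℝ) ^ 2) (wB c ((n : ℝ) ^ 2))
              (extOp ((i : ℝ) / (k : ℝ) + (J : ℝ) / (n : ℝ))
                ((i : ℝ) / (k : ℝ) + ((J : ℝ) + 1) / (n : ℝ)) g) ^ 2) ^ (p / 4) *
          (∑ J ∈ Finset.range (n / k),
            shLp p ((n : ℝ) ^ 2) (wB c ((n : ℝ) ^ 2))
              (extOp ((i' : ℝ) / (k : ℝ) + (J : ℝ) / (n : ℝ))
                ((i' : ℝ) / (k : ℝ) + ((J : ℝ) + 1) / (n : ℝ)) g) ^ 2) ^ (p / 4))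

/-- The bilinear decoupling constant `M_{p,b}(δ, ν)` with `δ = 1/n`, `ν = 1/k`. -/
def Mconst (p : ℝ) (n k b : ℕ) : ℝ := sInf {M : ℝ | 0 ≤ M ∧ BilIneq p n k b M}

/-- The Fourier transform of a function on `ℝ²`. -/
def ftR2 (η : ℝ × ℝ → ℝ) (ξ : ℝ × ℝ) : ℂ :=
  ∫ x : ℝ × ℝ, (η x : ℂ) * Complex.exp (-(2 * Real.pi * Complex.I) * ((x.1 * ξ.1 + x.2 * ξ.2 : ℝ) : ℂ))

end

namespace CircleExpSum

open scoped ENNReal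

open Complex in
/-- The plane wave with frequency `(cos θ, sin θ)`. -/
noncomputable def wave (θ : ℝ) (z : ℝ × ℝ) : ℂ :=
  exp (2 * Real.pi * I * ((Real.cos θ * z.1 + Real.sin θ * z.2 : ℝ) : ℂ))

/-- The exponential sum with frequencies at the angles in `Θ` and coefficients `c`. -/
noncomputable def expSum (Θ : Finset ℝ) (c : ℝ → ℂ) (z : ℝ × ℝ) : ℂ :=
  ∑ θ ∈ Θ, c θ * wave θ z

/-- The squared `ℓ²` norm of the coefficients. -/
noncomputable def energy (Θ : Finset ℝ) (c : ℝ → ℂ) : ℝ≥0∞ := ∑ θ ∈ Θ, ‖c θ‖ₑ ^ 2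

/-- On `Θ`, the coefficients `c` are supported in `[u, u + β]`. -/
def SuppIn (Θ : Finset ℝ) (c : ℝ → ℂ) (u β : ℝ) : Prop :=
  ∀ θ ∈ Θ, c θ ≠ 0 → u ≤ θ ∧ θ ≤ u + β

/-- The supports of `a` and `b` in `Θ` lie at distance at least `d`, one to the left of the
other. -/
def Separated (Θ : Finset ℝ) (d : ℝ) (a b : ℝ → ℂ) : Prop :=
  (∀ θ ∈ Θ, ∀ φ ∈ Θ, a θ ≠ 0 → b φ ≠ 0 → θ + d ≤ φ) ∨
    ∀ θ ∈ Θ, ∀ φ ∈ Θ, a θ ≠ 0 → b φ ≠ 0 → φ + d ≤ θ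

/-- `K` bounds the `p`-th moment of exponential sums over arcs of length `β`. -/
def LinBound (Θ : Finset ℝ) (μ : Measure (ℝ × ℝ)) (p β : ℝ) (K : ℝ≥0∞) : Prop :=
  ∀ u c, SuppIn Θ c u β → ∫⁻ z, ‖expSum Θ c z‖ₑ ^ p ∂μ ≤ K * energy Θ c ^ (p / 2)

/-- `K` bounds the mixed moments, with exponents `2` and `q`, of exponential sums over arcs of
lengths `γ` and `β` at distance at least `d`. -/
def BilBound (Θ : Finset ℝ) (μ : Measure (ℝ × ℝ)) (q d γ β : ℝ) (K : ℝ≥0∞) : Prop :=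
  ∀ u v a b, SuppIn Θ a u γ → SuppIn Θ b v β → Separated Θ d a b →
    ∫⁻ z, ‖expSum Θ a z‖ₑ ^ 2 * ‖expSum Θ b z‖ₑ ^ q ∂μ ≤ K * energy Θ a * energy Θ b ^ (q / 2)

/-- The weights `(2π)^k / k!` of the exponential series. -/
noncomputable def expWeight (k : ℕ) : ℝ≥0∞ := ENNReal.ofReal ((2 * Real.pi) ^ k / k.factorial)

lemma tsum_expWeight : ∑' k, expWeight k = ENNReal.ofReal (Real.exp (2 * Real.pi)) := by
  unfold expWeight
  rw [← ENNReal.ofReal_tsum_of_nonneg (fun k => by positivity)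
    (Real.summable_pow_div_factorial _), Real.exp_eq_exp_ℝ, NormedSpace.exp_eq_tsum_div]

lemma enorm_sum_mul_exp_le {ι : Type*} (s : Finset ι) (a : ι → ℂ) (ρ : ι → ℝ) {x : ℝ}
    (hx : |x| ≤ 1) :
    ‖∑ i ∈ s, a i * Complex.exp (2 * Real.pi * Complex.I * ((x * ρ i : ℝ) : ℂ))‖ₑ ≤
      ∑' k, expWeight k * ‖∑ i ∈ s, a i * (ρ i : ℂ) ^ k‖ₑ := by
  have h : HasSum (fun k : ℕ => ∑ i ∈ s,
      a i * ((2 * Real.pi * Complex.I * ((x * ρ i : ℝ) : ℂ)) ^ k / k.factorial))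
      (∑ i ∈ s, a i * Complex.exp (2 * Real.pi * Complex.I * ((x * ρ i : ℝ) : ℂ))) := by
    refine hasSum_sum fun i _ => HasSum.mul_left _ ?_
    rw [Complex.exp_eq_exp_ℂ]
    exact NormedSpace.expSeries_div_hasSum_exp _
  rw [← h.tsum_eq]
  refine enorm_tsum_le_tsum_enorm.trans (ENNReal.tsum_le_tsum fun k => ?_)
  have e : ∑ i ∈ s, a i * ((2 * Real.pi * Complex.I * ((x * ρ i : ℝ) : ℂ)) ^ k / k.factorial) =
      ((2 * Real.pi * Complex.I * x) ^ k / k.factorial) * ∑ i ∈ s, a i * (ρ i : ℂ) ^ k := by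
    rw [Finset.mul_sum]
    refine Finset.sum_congr rfl fun i _ => ?_
    push_cast
    ring
  rw [e, enorm_mul]
  gcongr
  rw [expWeight, ← ofReal_norm]
  refine ENNReal.ofReal_le_ofReal ?_
  rw [norm_div, norm_pow]
  simp only [norm_mul, Complex.norm_ofNat, Complex.norm_real, Complex.norm_I, mul_one,
    Complex.norm_natCast, Real.norm_eq_abs, abs_of_pos Real.pi_pos]
  have : 2 * Real.pi * |x| ≤ 2 * Real.pi := mul_le_of_le_one_right (by positivity) hx
  gcongr

lemma tsum_mul_rpow_le (w y : ℕ → ℝ≥0∞) {q : ℝ} (hq : 1 ≤ q) :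
    (∑' k, w k * y k) ^ q ≤ (∑' k, w k) ^ (q - 1) * ∑' k, w k * y k ^ q := by
  have hq0 : 0 < q := by linarith
  have h : ∑' k, w k * y k ≤ (∑' k, w k) ^ (1 - q⁻¹) * (∑' k, w k * y k ^ q) ^ q⁻¹ := by
    rw [ENNReal.tsum_eq_iSup_sum]
    refine iSup_le fun s => (ENNReal.inner_le_weight_mul_Lp_of_nonneg s hq w y).trans ?_
    have : q⁻¹ ≤ 1 := inv_le_one_of_one_le₀ hq
    have h1 : 0 ≤ 1 - q⁻¹ := by linarith
    gcongr <;> exact ENNReal.sum_le_tsum _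
  refine (ENNReal.rpow_le_rpow h hq0.le).trans_eq ?_
  rw [ENNReal.mul_rpow_of_nonneg _ _ hq0.le, ← ENNReal.rpow_mul, ← ENNReal.rpow_mul,
    inv_mul_cancel₀ hq0.ne', ENNReal.rpow_one, sub_mul, one_mul, inv_mul_cancel₀ hq0.ne']

lemma sum_exp_eq_zero {N : ℕ} (hN : 0 < N) {m : ℤ} (hm : ¬ (N : ℤ) ∣ m) :
    ∑ r ∈ Finset.range N, Complex.exp (2 * Real.pi * Complex.I * ((r / N * m : ℝ) : ℂ)) = 0 := by
  have hN' : (N : ℂ) ≠ 0 := by exact_mod_cast hN.ne'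
  set ζ := Complex.exp (2 * Real.pi * Complex.I * ((m / N : ℝ) : ℂ)) with hζ
  have e : ∀ r : ℕ, Complex.exp (2 * Real.pi * Complex.I * ((r / N * m : ℝ) : ℂ)) = ζ ^ r := by
    intro r
    rw [hζ, ← Complex.exp_nat_mul]
    congr 1
    push_cast
    ring
  have h1 : ζ ≠ 1 := by
    intro h
    obtain ⟨k, hk⟩ := Complex.exp_eq_one_iff.1 h
    apply hm
    refine ⟨k, ?_⟩
    have : ((m : ℂ) / N) = k := by
      have h2 : (2 * Real.pi * Complex.I : ℂ) ≠ 0 := Complex.two_pi_I_ne_zero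
      apply mul_left_cancel₀ h2
      push_cast at hk
      rw [hk]; ring
    field_simp at this
    exact_mod_cast this
  have hN1 : ζ ^ N = 1 := by
    rw [hζ, ← Complex.exp_nat_mul, Complex.exp_eq_one_iff]
    refine ⟨m, ?_⟩
    push_cast
    field_simp
  simp_rw [e]
  have := mul_geom_sum ζ N
  rw [hN1, sub_self] at this
  exact (mul_eq_zero.1 this).resolve_left (sub_ne_zero.2 h1)

lemma sum_enorm_sq_eq (S : Finset ℤ) (h : ℤ → ℂ) {N : ℕ} (hN : 0 < N)
    (hS : ∀ j ∈ S, ∀ k ∈ S, j ≠ k → ¬ (N : ℤ) ∣ j - k) :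
    ∑ r ∈ Finset.range N,
      ‖∑ j ∈ S, h j * Complex.exp (2 * Real.pi * Complex.I * ((r / N * j : ℝ) : ℂ))‖ₑ ^ 2 =
      N * ∑ j ∈ S, ‖h j‖ₑ ^ 2 := by
  have key : ∑ r ∈ Finset.range N,
      ‖∑ j ∈ S, h j * Complex.exp (2 * Real.pi * Complex.I * ((r / N * j : ℝ) : ℂ))‖ ^ 2 =
      N * ∑ j ∈ S, ‖h j‖ ^ 2 := by
    apply Complex.ofReal_injective
    push_cast
    simp_rw [← Complex.mul_conj', map_sum, Finset.sum_mul_sum]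
    rw [Finset.sum_comm, Finset.mul_sum]
    refine Finset.sum_congr rfl fun j hj => ?_
    rw [Finset.sum_comm, Finset.sum_eq_single j]
    · simp only [map_mul]
      have : ∀ x y : ℂ, h j * x * (starRingEnd ℂ (h j) * y) = h j * starRingEnd ℂ (h j) * (x * y) :=
        fun x y => by ring
      simp_rw [this, ← Finset.mul_sum, Complex.mul_conj']
      rw [mul_comm]
      congr 1
      rw [Finset.sum_congr rfl (g := fun _ => (1 : ℂ)) fun r _ => ?_]
      · simp
      have : (2 * Real.pi * Complex.I * ((r : ℂ) / N * j)) =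
        (((2 * Real.pi * (r / N * j) : ℝ)) : ℂ) * Complex.I := by push_cast; ring
      rw [this, Complex.norm_exp_ofReal_mul_I]
      simp
    · intro k hk hkj
      have := sum_exp_eq_zero hN (hS j hj k hk hkj.symm)
      rw [← mul_zero (h j * starRingEnd ℂ (h k)), ← this, Finset.mul_sum]
      refine Finset.sum_congr rfl fun r _ => ?_
      rw [map_mul, ← Complex.exp_conj]
      simp only [map_mul, Complex.conj_ofReal, Complex.conj_I, map_div₀, map_natCast, map_ofNat,
        map_intCast]
      rw [mul_mul_mul_comm, ← Complex.exp_add]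
      congr 2
      push_cast
      ring
    · exact fun hj' => absurd hj hj'
  have h2 := congrArg ENNReal.ofReal key
  rw [ENNReal.ofReal_sum_of_nonneg (fun _ _ => by positivity), ENNReal.ofReal_mul (by positivity),
    ENNReal.ofReal_sum_of_nonneg (fun _ _ => by positivity), ENNReal.ofReal_natCast] at h2
  simpa only [← ofReal_norm, ENNReal.ofReal_pow (norm_nonneg _)] using h2

lemma wave_add_smul (θ u t : ℝ) (z : ℝ × ℝ) :
    wave θ (z + t • (Real.cos u, Real.sin u)) =
      wave θ z * Complex.exp (2 * Real.pi * Complex.I * ((t * Real.cos (θ - u) : ℝ) : ℂ)) := by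
  rw [wave, wave, ← Complex.exp_add, Real.cos_sub]
  congr 1
  simp only [Prod.fst_add, Prod.snd_add, Prod.smul_mk, smul_eq_mul]
  push_cast
  ring

lemma enorm_expSum_add_smul_le (Θ : Finset ℝ) (c : ℝ → ℂ) (u T : ℝ) {x : ℝ} (hx : |x| ≤ 1)
    (z : ℝ × ℝ) :
    ‖expSum Θ c (z + (T * x) • (Real.cos u, Real.sin u))‖ₑ ≤
      ∑' k, expWeight k *
        ‖expSum Θ (fun θ => c θ * ((T * (Real.cos (θ - u) - 1) : ℝ) : ℂ) ^ k) z‖ₑ := by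
  have h := enorm_sum_mul_exp_le Θ (fun θ => c θ * wave θ z)
    (fun θ => T * (Real.cos (θ - u) - 1)) hx
  have e : expSum Θ c (z + (T * x) • (Real.cos u, Real.sin u)) =
      Complex.exp (((2 * Real.pi * (T * x) : ℝ) : ℂ) * Complex.I) *
      ∑ θ ∈ Θ, c θ * wave θ z *
        Complex.exp (2 * Real.pi * Complex.I * ((x * (T * (Real.cos (θ - u) - 1)) : ℝ) : ℂ)) := by
    rw [expSum, Finset.mul_sum]
    refine Finset.sum_congr rfl fun θ _ => ?_
    have e1 : Complex.exp (2 * Real.pi * Complex.I * ((T * x * Real.cos (θ - u) : ℝ) : ℂ)) =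
        Complex.exp (((2 * Real.pi * (T * x) : ℝ) : ℂ) * Complex.I) * Complex.exp
          (2 * Real.pi * Complex.I * ((x * (T * (Real.cos (θ - u) - 1)) : ℝ) : ℂ)) := by
      rw [← Complex.exp_add]
      congr 1
      push_cast
      ring
    rw [wave_add_smul, e1]
    ring
  rw [e, enorm_mul, ← ofReal_norm, Complex.norm_exp_ofReal_mul_I, ENNReal.ofReal_one,
    one_mul]
  refine h.trans_eq (tsum_congr fun k => ?_)
  simp only [expSum]
  congr 2
  exact Finset.sum_congr rfl fun θ _ => by ring

lemma sum_enorm_expSum_sq_le (Θ : Finset ℝ) (c : ℝ → ℂ) (u T : ℝ) {N : ℕ} (hN : 0 < N)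
    (hNΘ : ∀ θ ∈ Θ, ∀ φ ∈ Θ, ⌊T * Real.cos (θ - u)⌋ ≠ ⌊T * Real.cos (φ - u)⌋ →
      ¬ (N : ℤ) ∣ ⌊T * Real.cos (θ - u)⌋ - ⌊T * Real.cos (φ - u)⌋) (z : ℝ × ℝ) :
    ∑ r ∈ Finset.range N, ‖expSum Θ c (z + (T * (r / N)) • (Real.cos u, Real.sin u))‖ₑ ^ 2 ≤
      ENNReal.ofReal (Real.exp (2 * Real.pi)) * ∑' k, expWeight k * (N *
        ∑ j ∈ Θ.image fun θ => ⌊T * Real.cos (θ - u)⌋,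
          ‖expSum Θ (fun θ => if ⌊T * Real.cos (θ - u)⌋ = j then
            c θ * ((Int.fract (T * Real.cos (θ - u)) : ℝ) : ℂ) ^ k else 0) z‖ₑ ^ 2) := by
  have h1 : ∀ r ∈ Finset.range N,
      ‖expSum Θ c (z + (T * (r / N)) • (Real.cos u, Real.sin u))‖ₑ ^ 2 ≤
      ENNReal.ofReal (Real.exp (2 * Real.pi)) * ∑' k, expWeight k *
        ‖∑ j ∈ Θ.image fun θ => ⌊T * Real.cos (θ - u)⌋,
          expSum Θ (fun θ => if ⌊T * Real.cos (θ - u)⌋ = j then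
            c θ * ((Int.fract (T * Real.cos (θ - u)) : ℝ) : ℂ) ^ k else 0) z *
          Complex.exp (2 * Real.pi * Complex.I * ((r / N * j : ℝ) : ℂ))‖ₑ ^ 2 := by
    intro r hr
    have hx : |(r / N : ℝ)| ≤ 1 := by
      rw [abs_of_nonneg (by positivity)]
      exact div_le_one_of_le₀ (by exact_mod_cast (Finset.mem_range.1 hr).le) (by positivity)
    have h := enorm_sum_mul_exp_le Θ (fun θ => c θ * wave θ z *
      Complex.exp (2 * Real.pi * Complex.I * ((r / N * ⌊T * Real.cos (θ - u)⌋ : ℝ) : ℂ)))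
      (fun θ => Int.fract (T * Real.cos (θ - u))) hx
    have e : expSum Θ c (z + (T * (r / N)) • (Real.cos u, Real.sin u)) =
        ∑ θ ∈ Θ, c θ * wave θ z *
          Complex.exp (2 * Real.pi * Complex.I * ((r / N * ⌊T * Real.cos (θ - u)⌋ : ℝ) : ℂ)) *
          Complex.exp (2 * Real.pi * Complex.I *
            ((r / N * Int.fract (T * Real.cos (θ - u)) : ℝ) : ℂ)) := by
      refine Finset.sum_congr rfl fun θ _ => ?_
      rw [wave_add_smul, mul_assoc (c θ * _), ← Complex.exp_add, ← mul_assoc, ← mul_add,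
        ← Complex.ofReal_add, ← mul_add, Int.floor_add_fract, ← mul_assoc _ T, mul_comm T]
    rw [← e] at h
    have h2 := ENNReal.rpow_le_rpow h (z := 2) (by norm_num)
    have h3 := h2.trans (tsum_mul_rpow_le _ _ (by norm_num))
    rw [tsum_expWeight] at h3
    rw [ENNReal.rpow_two, show (2 : ℝ) - 1 = 1 by norm_num, ENNReal.rpow_one] at h3
    refine h3.trans_eq ?_
    congr 1
    refine tsum_congr fun k => ?_
    rw [ENNReal.rpow_two]
    congr 3
    have hmaps : ∀ θ ∈ Θ, ⌊T * Real.cos (θ - u)⌋ ∈ Θ.image fun θ => ⌊T * Real.cos (θ - u)⌋ :=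
      fun θ hθ => Finset.mem_image_of_mem _ hθ
    symm
    rw [← Finset.sum_fiberwise_of_maps_to hmaps]
    refine Finset.sum_congr rfl fun j _ => ?_
    rw [expSum, Finset.sum_mul, Finset.sum_filter]
    symm
    refine Finset.sum_congr rfl fun θ _ => ?_
    split_ifs with hj
    · rw [← hj]; push_cast; ring
    · simp
  refine (Finset.sum_le_sum h1).trans_eq ?_
  rw [← Finset.mul_sum, ← Summable.tsum_finsetSum (fun _ _ => ENNReal.summable)]
  congr 1
  refine tsum_congr fun k => ?_
  rw [← Finset.mul_sum, sum_enorm_sq_eq _ _ hN]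
  intro i hi j hj hij
  obtain ⟨θ, hθ, rfl⟩ := Finset.mem_image.1 hi
  obtain ⟨φ, hφ, rfl⟩ := Finset.mem_image.1 hj
  exact hNΘ θ hθ φ hφ hij

@[fun_prop]
lemma continuous_expSum (Θ : Finset ℝ) (c : ℝ → ℂ) : Continuous (expSum Θ c) := by
  unfold expSum wave
  fun_prop

lemma energy_mono {Θ : Finset ℝ} {a b : ℝ → ℂ} (h : ∀ θ ∈ Θ, ‖a θ‖ₑ ≤ ‖b θ‖ₑ) :
    energy Θ a ≤ energy Θ b :=
  Finset.sum_le_sum fun θ hθ => by gcongr; exact h θ hθ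

lemma sum_energy_fiber {ι : Type*} [DecidableEq ι] (Θ : Finset ℝ) (c : ℝ → ℂ) (f : ℝ → ι)
    {S : Finset ι} (hf : ∀ θ ∈ Θ, c θ ≠ 0 → f θ ∈ S) :
    ∑ j ∈ S, energy Θ (fun θ => if f θ = j then c θ else 0) = energy Θ c := by
  simp only [energy]
  rw [Finset.sum_comm]
  refine Finset.sum_congr rfl fun θ hθ => ?_
  by_cases h : c θ = 0
  · simp [h]
  · rw [Finset.sum_eq_single (f θ)]
    · simp
    · intro j _ hj
      simp [hj.symm]
    · exact fun h' => absurd (hf θ hθ h) h'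

lemma sum_expSum_fiber {ι : Type*} [DecidableEq ι] (Θ : Finset ℝ) (c : ℝ → ℂ) (f : ℝ → ι)
    {S : Finset ι} (hf : ∀ θ ∈ Θ, c θ ≠ 0 → f θ ∈ S) (z : ℝ × ℝ) :
    ∑ j ∈ S, expSum Θ (fun θ => if f θ = j then c θ else 0) z = expSum Θ c z := by
  simp only [expSum]
  rw [Finset.sum_comm]
  refine Finset.sum_congr rfl fun θ hθ => ?_
  by_cases h : c θ = 0
  · simp [h]
  · rw [Finset.sum_eq_single (f θ)]
    · simp
    · intro j _ hj
      simp [hj.symm]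
    · exact fun h' => absurd (hf θ hθ h) h'

lemma mul_sub_le_cos_sub_cos {d x y : ℝ} (hd : 0 < d) (hx : d ≤ x) (hxy : x ≤ y) (hy : y ≤ 1) :
    d * (y - x) / 3 ≤ Real.cos x - Real.cos y := by
  have hpi := Real.pi_gt_three
  have hpi' := Real.pi_lt_d2
  have h1 := Real.mul_le_sin (x := (x + y) / 2) (by linarith) (by linarith)
  have h2 := Real.mul_le_sin (x := (y - x) / 2) (by linarith) (by linarith)
  have h3 : Real.cos x - Real.cos y = 2 * Real.sin ((x + y) / 2) * Real.sin ((y - x) / 2) := by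
    rw [Real.cos_sub_cos, show (x - y) / 2 = -((y - x) / 2) by ring, Real.sin_neg]
    ring
  have h4 : (3 / 5 : ℝ) ≤ 2 / Real.pi := by
    rw [div_le_div_iff₀ (by norm_num) Real.pi_pos]
    linarith
  have h5 : 3 / 5 * d ≤ Real.sin ((x + y) / 2) :=
    (mul_le_mul h4 (by linarith) hd.le (by positivity)).trans h1
  have h6 : 3 / 5 * ((y - x) / 2) ≤ Real.sin ((y - x) / 2) :=
    (mul_le_mul_of_nonneg_right h4 (by linarith)).trans h2
  have h7 := mul_le_mul h5 h6 (by linarith) (by linarith [h5])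
  rw [h3]
  nlinarith [mul_nonneg hd.le (sub_nonneg.2 hxy)]

lemma sub_le_of_floor_eq {T d u x y : ℝ} (hT : 0 < T) (hd : 0 < d) (hxy : x ≤ y)
    (hx : |x - u| ≤ 1) (hy : |y - u| ≤ 1)
    (hside : (y + d ≤ u) ∨ (u + d ≤ x))
    (hf : ⌊T * Real.cos (x - u)⌋ = ⌊T * Real.cos (y - u)⌋) : y - x ≤ 3 / T / d := by
  have h1 := Int.abs_sub_lt_one_of_floor_eq_floor hf
  rw [← mul_sub, abs_lt] at h1
  have h2 : d * (y - x) / 3 * T ≤ 1 := by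
    rcases hside with h | h
    · have := mul_sub_le_cos_sub_cos (x := u - y) (y := u - x) hd (by linarith) (by linarith)
        (by linarith [(abs_le.1 hx).1])
      rw [← Real.cos_neg (u - y), ← Real.cos_neg (u - x), neg_sub, neg_sub] at this
      nlinarith
    · have := mul_sub_le_cos_sub_cos (x := x - u) (y := y - u) hd (by linarith) (by linarith)
        (by linarith [(abs_le.1 hy).2])
      nlinarith
  rw [div_div, le_div_iff₀ (by positivity)]
  nlinarith

lemma exists_suppIn_of_floor_eq {Θ : Finset ℝ} {b : ℝ → ℂ} {T d u : ℝ} {j : ℤ} (hT : 0 < T)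
    (hd : 0 < d) (hu : u ∈ Θ) (hdiam : ∀ θ ∈ Θ, ∀ φ ∈ Θ, |θ - φ| ≤ 1)
    (hside : (∀ θ ∈ Θ, b θ ≠ 0 → θ + d ≤ u) ∨ (∀ θ ∈ Θ, b θ ≠ 0 → u + d ≤ θ))
    (hj : ∀ θ ∈ Θ, b θ ≠ 0 → ⌊T * Real.cos (θ - u)⌋ = j) :
    ∃ w, SuppIn Θ b w (3 / T / d) := by
  rcases (Θ.filter fun θ => b θ ≠ 0).eq_empty_or_nonempty with h | h
  · refine ⟨0, fun θ hθ h0 => ?_⟩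
    exact absurd (Finset.mem_filter.2 ⟨hθ, h0⟩) (Finset.eq_empty_iff_forall_notMem.1 h θ)
  · obtain ⟨w, hw, hmin⟩ := Finset.exists_min_image _ id h
    obtain ⟨hwΘ, hw0⟩ := Finset.mem_filter.1 hw
    refine ⟨w, fun θ hθ h0 => ?_⟩
    have hwθ : w ≤ θ := hmin θ (Finset.mem_filter.2 ⟨hθ, h0⟩)
    have := sub_le_of_floor_eq hT hd hwθ (hdiam w hwΘ u hu) (hdiam θ hθ u hu)
      (hside.imp (fun h => h θ hθ h0) (fun h => h w hwΘ hw0))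
      ((hj w hwΘ hw0).trans (hj θ hθ h0).symm)
    exact ⟨hwθ, by linarith⟩

/-- Translations by vectors of length at most `R` change `μ` by a factor of at most `D`. -/
def AlmostInvariant (μ : Measure (ℝ × ℝ)) (R : ℝ) (D : ℝ≥0∞) : Prop :=
  ∀ v : ℝ × ℝ, ‖v‖ ≤ R → ∀ g : ℝ × ℝ → ℝ≥0∞, Measurable g → ∫⁻ z, g z ∂μ ≤ D * ∫⁻ z, g (z + v) ∂μ

lemma lintegral_le_of_almostInvariant {Θ : Finset ℝ} {μ : Measure (ℝ × ℝ)} {q T : ℝ} {D : ℝ≥0∞}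
    (hq : 1 ≤ q) (hT : 0 ≤ T) (hμ : AlmostInvariant μ T D) (a b : ℝ → ℂ) (u : ℝ) :
    ∫⁻ z, ‖expSum Θ a z‖ₑ ^ 2 * ‖expSum Θ b z‖ₑ ^ q ∂μ ≤
      D * ENNReal.ofReal (Real.exp (2 * Real.pi)) ^ q *
        ∑' k, ∑' l, expWeight k * expWeight l * ∑ j ∈ Θ.image fun θ => ⌊T * Real.cos (θ - u)⌋,
          ∫⁻ z, ‖expSum Θ (fun θ => if ⌊T * Real.cos (θ - u)⌋ = j then
              a θ * ((Int.fract (T * Real.cos (θ - u)) : ℝ) : ℂ) ^ k else 0) z‖ₑ ^ 2 *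
            ‖expSum Θ (fun θ => b θ * ((T * (Real.cos (θ - u) - 1) : ℝ) : ℂ) ^ l) z‖ₑ ^ q ∂μ := by
  set E := ENNReal.ofReal (Real.exp (2 * Real.pi)) with hE
  set J := Θ.image fun θ => ⌊T * Real.cos (θ - u)⌋ with hJ
  set A : ℕ → ℤ → ℝ → ℂ := fun k j θ => if ⌊T * Real.cos (θ - u)⌋ = j then
              a θ * ((Int.fract (T * Real.cos (θ - u)) : ℝ) : ℂ) ^ k else 0 with hA
  set B : ℕ → ℝ → ℂ := fun l θ => b θ * ((T * (Real.cos (θ - u) - 1) : ℝ) : ℂ) ^ l with hB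
  obtain ⟨N, hN, hNJ⟩ : ∃ N : ℕ, 0 < N ∧ ∀ i ∈ J, ∀ j ∈ J, i ≠ j → ¬ (N : ℤ) ∣ i - j := by
    refine ⟨∑ x ∈ J ×ˢ J, (x.1 - x.2).natAbs + 1, Nat.succ_pos _, fun i hi j hj hij hdvd => ?_⟩
    have h1 := Int.natAbs_dvd_natAbs.2 hdvd
    rw [Int.natAbs_natCast] at h1
    have h2 := Nat.le_of_dvd (Int.natAbs_pos.2 (sub_ne_zero.2 hij)) h1
    have h3 := Finset.single_le_sum (f := fun x : ℤ × ℤ => (x.1 - x.2).natAbs)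
      (fun _ _ => Nat.zero_le _) (Finset.mk_mem_product hi hj)
    simp only at h3
    omega
  have hN0 : (N : ℝ≥0∞) ≠ 0 := by exact_mod_cast hN.ne'
  set n : ℝ × ℝ := (Real.cos u, Real.sin u) with hn
  set v : ℕ → ℝ × ℝ := fun r => (T * (r / N)) • n with hv
  have hvT : ∀ r ∈ Finset.range N, ‖v r‖ ≤ T := by
    intro r hr
    have h1 : ‖n‖ ≤ 1 := by
      rw [Prod.norm_def]
      exact max_le (Real.abs_cos_le_one u) (Real.abs_sin_le_one u)
    have h2 : (r / N : ℝ) ≤ 1 :=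
      div_le_one_of_le₀ (by exact_mod_cast (Finset.mem_range.1 hr).le) (by positivity)
    rw [hv, norm_smul, Real.norm_of_nonneg (by positivity)]
    calc T * (r / N) * ‖n‖ ≤ T * 1 * 1 := by gcongr
      _ = T := by ring
  have hpt : ∀ z, ∑ r ∈ Finset.range N, ‖expSum Θ a (z + v r)‖ₑ ^ 2 * ‖expSum Θ b (z + v r)‖ₑ ^ q ≤
      N * (E ^ q * ∑' k, ∑' l, expWeight k * expWeight l * ∑ j ∈ J,
        ‖expSum Θ (A k j) z‖ₑ ^ 2 * ‖expSum Θ (B l) z‖ₑ ^ q) := by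
    intro z
    have hb : ∀ r ∈ Finset.range N, ‖expSum Θ b (z + v r)‖ₑ ^ q ≤
        E ^ (q - 1) * ∑' l, expWeight l * ‖expSum Θ (B l) z‖ₑ ^ q := by
      intro r hr
      have hx : |(r / N : ℝ)| ≤ 1 := by
        rw [abs_of_nonneg (by positivity)]
        exact div_le_one_of_le₀ (by exact_mod_cast (Finset.mem_range.1 hr).le) (by positivity)
      have h := ENNReal.rpow_le_rpow (enorm_expSum_add_smul_le Θ b u T hx z) (z := q) (by linarith)
      refine h.trans ((tsum_mul_rpow_le _ _ hq).trans_eq ?_)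
      rw [tsum_expWeight]
    have ha := sum_enorm_expSum_sq_le Θ a u T hN (fun θ hθ φ hφ h => hNJ _
      (Finset.mem_image_of_mem _ hθ) _ (Finset.mem_image_of_mem _ hφ) h) z
    calc _ ≤ ∑ r ∈ Finset.range N, ‖expSum Θ a (z + v r)‖ₑ ^ 2 *
          (E ^ (q - 1) * ∑' l, expWeight l * ‖expSum Θ (B l) z‖ₑ ^ q) :=
          Finset.sum_le_sum fun r hr => by gcongr; exact hb r hr
      _ ≤ (E * ∑' k, expWeight k * (N * ∑ j ∈ J, ‖expSum Θ (A k j) z‖ₑ ^ 2)) *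
          (E ^ (q - 1) * ∑' l, expWeight l * ‖expSum Θ (B l) z‖ₑ ^ q) := by
          rw [← Finset.sum_mul]
          gcongr
      _ = _ := by
          have hEq : E ^ q = E * E ^ (q - 1) := by
            conv_lhs => rw [show q = 1 + (q - 1) by ring]
            rw [ENNReal.rpow_add_of_nonneg _ _ (by norm_num) (by linarith), ENNReal.rpow_one]
          have e1 : ∑' k, expWeight k * (N * ∑ j ∈ J, ‖expSum Θ (A k j) z‖ₑ ^ 2) =
              N * ∑' k, expWeight k * ∑ j ∈ J, ‖expSum Θ (A k j) z‖ₑ ^ 2 := by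
            rw [← ENNReal.tsum_mul_left]
            exact tsum_congr fun k => by ring
          have e2 : ∑' k, ∑' l, expWeight k * expWeight l * ∑ j ∈ J,
                ‖expSum Θ (A k j) z‖ₑ ^ 2 * ‖expSum Θ (B l) z‖ₑ ^ q =
              (∑' k, expWeight k * ∑ j ∈ J, ‖expSum Θ (A k j) z‖ₑ ^ 2) *
                ∑' l, expWeight l * ‖expSum Θ (B l) z‖ₑ ^ q := by
            rw [← ENNReal.tsum_mul_right]
            refine tsum_congr fun k => ?_
            rw [← ENNReal.tsum_mul_left]
            refine tsum_congr fun l => ?_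
            rw [← Finset.sum_mul]
            ring
          rw [e1, e2, hEq]
          ring
  have hmeas : ∀ a b : ℝ → ℂ,
      Measurable fun z => ‖expSum Θ a z‖ₑ ^ 2 * ‖expSum Θ b z‖ₑ ^ q := by
    intro a b
    have h1 := (continuous_expSum Θ a).measurable
    have h2 := (continuous_expSum Θ b).measurable
    fun_prop
  have hmain : N * ∫⁻ z, ‖expSum Θ a z‖ₑ ^ 2 * ‖expSum Θ b z‖ₑ ^ q ∂μ ≤
      N * (D * E ^ q * ∑' k, ∑' l, expWeight k * expWeight l * ∑ j ∈ J,
        ∫⁻ z, ‖expSum Θ (A k j) z‖ₑ ^ 2 * ‖expSum Θ (B l) z‖ₑ ^ q ∂μ) := by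
    calc _ = ∑ r ∈ Finset.range N, ∫⁻ z, ‖expSum Θ a z‖ₑ ^ 2 * ‖expSum Θ b z‖ₑ ^ q ∂μ := by
          simp
      _ ≤ ∑ r ∈ Finset.range N,
          D * ∫⁻ z, ‖expSum Θ a (z + v r)‖ₑ ^ 2 * ‖expSum Θ b (z + v r)‖ₑ ^ q ∂μ :=
          Finset.sum_le_sum fun r hr => hμ (v r) (hvT r hr) _ (hmeas a b)
      _ = D * ∫⁻ z, ∑ r ∈ Finset.range N,
          ‖expSum Θ a (z + v r)‖ₑ ^ 2 * ‖expSum Θ b (z + v r)‖ₑ ^ q ∂μ := by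
          rw [lintegral_finsetSum, Finset.mul_sum]
          exact fun r _ => (hmeas a b).comp (measurable_add_const (v r))
      _ ≤ D * ∫⁻ z, N * (E ^ q * ∑' k, ∑' l, expWeight k * expWeight l * ∑ j ∈ J,
          ‖expSum Θ (A k j) z‖ₑ ^ 2 * ‖expSum Θ (B l) z‖ₑ ^ q) ∂μ := by
          gcongr with z
          exact hpt z
      _ = _ := by
          have m1 : ∀ k l, Measurable fun z => ∑ j ∈ J,
              ‖expSum Θ (A k j) z‖ₑ ^ 2 * ‖expSum Θ (B l) z‖ₑ ^ q :=
            fun k l => Finset.measurable_fun_sum _ fun j _ => hmeas _ _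
          have m2 : ∀ k l, Measurable fun z => expWeight k * expWeight l * ∑ j ∈ J,
              ‖expSum Θ (A k j) z‖ₑ ^ 2 * ‖expSum Θ (B l) z‖ₑ ^ q :=
            fun k l => (m1 k l).const_mul _
          have m3 : ∀ k, Measurable fun z => ∑' l, expWeight k * expWeight l * ∑ j ∈ J,
              ‖expSum Θ (A k j) z‖ₑ ^ 2 * ‖expSum Θ (B l) z‖ₑ ^ q :=
            fun k => Measurable.tsum fun l => m2 k l
          have m4 : Measurable fun z => ∑' k, ∑' l, expWeight k * expWeight l * ∑ j ∈ J,
              ‖expSum Θ (A k j) z‖ₑ ^ 2 * ‖expSum Θ (B l) z‖ₑ ^ q :=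
            Measurable.tsum m3
          rw [lintegral_const_mul _ (m4.const_mul _), lintegral_const_mul _ m4,
            lintegral_tsum fun k => (m3 k).aemeasurable]
          have e : ∀ k, ∫⁻ z, ∑' l, expWeight k * expWeight l * ∑ j ∈ J,
              ‖expSum Θ (A k j) z‖ₑ ^ 2 * ‖expSum Θ (B l) z‖ₑ ^ q ∂μ =
              ∑' l, expWeight k * expWeight l * ∑ j ∈ J,
              ∫⁻ z, ‖expSum Θ (A k j) z‖ₑ ^ 2 * ‖expSum Θ (B l) z‖ₑ ^ q ∂μ := by
            intro k
            rw [lintegral_tsum fun l => (m2 k l).aemeasurable]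
            refine tsum_congr fun l => ?_
            rw [lintegral_const_mul _ (m1 k l), lintegral_finsetSum _ fun j _ => hmeas _ _]
          simp_rw [e]
          ring
  exact (ENNReal.mul_le_mul_iff_right hN0 (ENNReal.natCast_ne_top N)).1 hmain

/-- Transversality makes short pieces of the first arc orthogonal against the second factor. -/
lemma BilBound.of_short {Θ : Finset ℝ} {μ : Measure (ℝ × ℝ)} {q d β : ℝ} {D K : ℝ≥0∞}
    (hq : 1 ≤ q) (hd : 0 < d) (hβ : 0 < β) (hdiam : ∀ θ ∈ Θ, ∀ φ ∈ Θ, |θ - φ| ≤ 1)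
    (hμ : AlmostInvariant μ (1 / β ^ 2) D) (h : BilBound Θ μ q d (3 * β ^ 2 / d) β K) (γ : ℝ) :
    BilBound Θ μ q d γ β (D * ENNReal.ofReal (Real.exp (2 * Real.pi)) ^ (q + 2) * K) := by
  intro _ v a b _ hb hsep
  by_cases hb0 : ∀ θ ∈ Θ, b θ = 0
  · have : ∀ z, expSum Θ b z = 0 := fun z =>
      Finset.sum_eq_zero fun θ hθ => by rw [hb0 θ hθ, zero_mul]
    simp [this, ENNReal.zero_rpow_of_pos (by linarith : 0 < q)]
  push Not at hb0
  obtain ⟨u, hu, hbu⟩ := hb0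
  set T := 1 / β ^ 2 with hT
  have hT0 : 0 < T := by positivity
  have h3T : 3 / T / d = 3 * β ^ 2 / d := by rw [hT]; field_simp
  refine (lintegral_le_of_almostInvariant hq hT0.le hμ a b u).trans ?_
  set E := ENNReal.ofReal (Real.exp (2 * Real.pi)) with hE
  have hterm : ∀ k l, ∑ j ∈ Θ.image fun θ => ⌊T * Real.cos (θ - u)⌋,
          ∫⁻ z, ‖expSum Θ (fun θ => if ⌊T * Real.cos (θ - u)⌋ = j then
              a θ * ((Int.fract (T * Real.cos (θ - u)) : ℝ) : ℂ) ^ k else 0) z‖ₑ ^ 2 *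
            ‖expSum Θ (fun θ => b θ * ((T * (Real.cos (θ - u) - 1) : ℝ) : ℂ) ^ l) z‖ₑ ^ q ∂μ ≤
      K * energy Θ a * energy Θ b ^ (q / 2) := by
    intro k l
    set b' : ℝ → ℂ := fun θ => b θ * ((T * (Real.cos (θ - u) - 1) : ℝ) : ℂ) ^ l with hb'
    have hbb' : ∀ θ, b' θ ≠ 0 → b θ ≠ 0 := fun θ => left_ne_zero_of_mul
    have hEb : energy Θ b' ≤ energy Θ b := by
      refine energy_mono fun θ hθ => ?_
      by_cases h0 : b θ = 0
      · simp [hb', h0]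
      rw [hb', enorm_mul, enorm_pow]
      refine mul_le_of_le_one_right' (pow_le_one' ?_ l)
      rw [← ofReal_norm, Complex.norm_real, ENNReal.ofReal_le_one, Real.norm_eq_abs, abs_mul,
        abs_of_pos hT0, hT, one_div, inv_mul_le_iff₀ (by positivity), mul_one, abs_sub_comm,
        abs_of_nonneg (sub_nonneg.2 (Real.cos_le_one _))]
      have h1 := Real.one_sub_sq_div_two_le_cos (x := θ - u)
      obtain ⟨h2, h3⟩ := hb θ hθ h0
      obtain ⟨h4, h5⟩ := hb u hu hbu
      have : (θ - u) ^ 2 ≤ β ^ 2 := sq_le_sq' (by linarith) (by linarith)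
      nlinarith
    have hA : ∀ j θ, (if ⌊T * Real.cos (θ - u)⌋ = j then
        a θ * ((Int.fract (T * Real.cos (θ - u)) : ℝ) : ℂ) ^ k else 0) ≠ 0 →
        a θ ≠ 0 ∧ ⌊T * Real.cos (θ - u)⌋ = j := by
      intro j θ h
      split_ifs at h with h'
      · exact ⟨left_ne_zero_of_mul h, h'⟩
      · exact absurd rfl h
    have hone : ∀ j ∈ Θ.image fun θ => ⌊T * Real.cos (θ - u)⌋,
        ∫⁻ z, ‖expSum Θ (fun θ => if ⌊T * Real.cos (θ - u)⌋ = j then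
              a θ * ((Int.fract (T * Real.cos (θ - u)) : ℝ) : ℂ) ^ k else 0) z‖ₑ ^ 2 *
            ‖expSum Θ b' z‖ₑ ^ q ∂μ ≤
        K * energy Θ (fun θ => if ⌊T * Real.cos (θ - u)⌋ = j then a θ else 0) *
          energy Θ b ^ (q / 2) := by
      intro j _
      obtain ⟨w, hw⟩ := exists_suppIn_of_floor_eq (b := fun θ => if ⌊T * Real.cos (θ - u)⌋ = j then
              a θ * ((Int.fract (T * Real.cos (θ - u)) : ℝ) : ℂ) ^ k else 0) hT0 hd hu hdiam
        (hsep.imp (fun h θ hθ h0 => h θ hθ u hu (hA j θ h0).1 hbu)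
          (fun h θ hθ h0 => h θ hθ u hu (hA j θ h0).1 hbu)) (fun θ _ h0 => (hA j θ h0).2)
      rw [h3T] at hw
      refine (h w v _ b' hw (fun θ hθ h0 => hb θ hθ (hbb' θ h0))
        (hsep.imp (fun h θ hθ φ hφ h0 h1 => h θ hθ φ hφ (hA j θ h0).1 (hbb' φ h1))
          (fun h θ hθ φ hφ h0 h1 => h θ hθ φ hφ (hA j θ h0).1 (hbb' φ h1)))).trans ?_
      gcongr K * ?_ * ?_
      · refine energy_mono fun θ _ => ?_
        split_ifs
        · rw [enorm_mul, enorm_pow]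
          refine mul_le_of_le_one_right' (pow_le_one' ?_ k)
          rw [← ofReal_norm, Complex.norm_real, ENNReal.ofReal_le_one, Real.norm_eq_abs,
            abs_of_nonneg (Int.fract_nonneg _)]
          exact (Int.fract_lt_one _).le
        · simp
      · have : 0 ≤ q / 2 := by linarith
        gcongr
    refine (Finset.sum_le_sum hone).trans_eq ?_
    rw [← Finset.sum_mul, ← Finset.mul_sum, sum_energy_fiber]
    exact fun θ hθ _ => Finset.mem_image_of_mem _ hθ
  calc _ ≤ D * E ^ q * ∑' k, ∑' l, expWeight k * expWeight l *
        (K * energy Θ a * energy Θ b ^ (q / 2)) := by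
        gcongr with k l
        exact hterm k l
    _ = D * E ^ q * (E * E) * K * energy Θ a * energy Θ b ^ (q / 2) := by
        simp_rw [ENNReal.tsum_mul_right, ENNReal.tsum_mul_left, ENNReal.tsum_mul_right,
          tsum_expWeight, ← hE]
        ring
    _ = _ := by
        rw [ENNReal.rpow_add_of_nonneg _ _ (by linarith) (by norm_num), ENNReal.rpow_two]
        ring

lemma SuppIn.mono {Θ : Finset ℝ} {c : ℝ → ℂ} {u β β' : ℝ} (h : SuppIn Θ c u β) (hβ : β ≤ β') :
    SuppIn Θ c u β' :=
  fun θ hθ h0 => ⟨(h θ hθ h0).1, by linarith [(h θ hθ h0).2]⟩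

lemma BilBound.mono_left {Θ : Finset ℝ} {μ : Measure (ℝ × ℝ)} {q d γ γ' β : ℝ} {K : ℝ≥0∞}
    (h : BilBound Θ μ q d γ' β K) (hγ : γ ≤ γ') : BilBound Θ μ q d γ β K :=
  fun u v a b ha hb hs => h u v a b (ha.mono hγ) hb hs

lemma Separated.symm {Θ : Finset ℝ} {d : ℝ} {a b : ℝ → ℂ} (h : Separated Θ d a b) :
    Separated Θ d b a :=
  (Or.symm h).imp (fun h θ hθ φ hφ h0 h1 => h φ hφ θ hθ h1 h0)
    (fun h θ hθ φ hφ h0 h1 => h φ hφ θ hθ h1 h0)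

lemma aemeasurable_enorm_expSum (Θ : Finset ℝ) (μ : Measure (ℝ × ℝ)) (c : ℝ → ℂ) :
    AEMeasurable (fun z => ‖expSum Θ c z‖ₑ) μ :=
  (continuous_expSum Θ c).measurable.enorm.aemeasurable

lemma BilBound.of_linBound {Θ : Finset ℝ} {μ : Measure (ℝ × ℝ)} {q β : ℝ} {G : ℝ≥0∞} (hq : 0 < q)
    (h : LinBound Θ μ (q + 2) β G) (d : ℝ) : BilBound Θ μ q d β β G := by
  intro u v a b ha hb _
  have hα : 0 ≤ 2 / (q + 2) := by positivity
  have hα' : 0 ≤ q / (q + 2) := by positivity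
  have hsum : 2 / (q + 2) + q / (q + 2) = 1 := by field_simp; ring
  have e2 : (q + 2) * (2 / (q + 2)) = 2 := by field_simp
  have eq : (q + 2) * (q / (q + 2)) = q := by field_simp
  calc ∫⁻ z, ‖expSum Θ a z‖ₑ ^ 2 * ‖expSum Θ b z‖ₑ ^ q ∂μ
      = ∫⁻ z, (‖expSum Θ a z‖ₑ ^ (q + 2)) ^ (2 / (q + 2)) *
          (‖expSum Θ b z‖ₑ ^ (q + 2)) ^ (q / (q + 2)) ∂μ := by
        simp_rw [← ENNReal.rpow_mul, e2, eq, ENNReal.rpow_two]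
    _ ≤ (∫⁻ z, ‖expSum Θ a z‖ₑ ^ (q + 2) ∂μ) ^ (2 / (q + 2)) *
          (∫⁻ z, ‖expSum Θ b z‖ₑ ^ (q + 2) ∂μ) ^ (q / (q + 2)) :=
        ENNReal.lintegral_mul_norm_pow_le ((aemeasurable_enorm_expSum Θ μ a).pow_const _)
          ((aemeasurable_enorm_expSum Θ μ b).pow_const _) hα hα' hsum
    _ ≤ (G * energy Θ a ^ ((q + 2) / 2)) ^ (2 / (q + 2)) *
          (G * energy Θ b ^ ((q + 2) / 2)) ^ (q / (q + 2)) := by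
        gcongr
        · exact h u a ha
        · exact h v b hb
    _ = G ^ (2 / (q + 2) + q / (q + 2)) * energy Θ a * energy Θ b ^ (q / 2) := by
        rw [ENNReal.mul_rpow_of_nonneg _ _ hα, ENNReal.mul_rpow_of_nonneg _ _ hα',
          ← ENNReal.rpow_mul, ← ENNReal.rpow_mul, ENNReal.rpow_add_of_nonneg _ _ hα hα',
          show (q + 2) / 2 * (2 / (q + 2)) = 1 by field_simp,
          show (q + 2) / 2 * (q / (q + 2)) = q / 2 by field_simp, ENNReal.rpow_one]
        ring
    _ = _ := by rw [hsum, ENNReal.rpow_one]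

/-- Hölder's inequality exchanges the roles of the two arcs. -/
lemma BilBound.swap {Θ : Finset ℝ} {μ : Measure (ℝ × ℝ)} {q d γ β : ℝ} {K G : ℝ≥0∞} (hq : 2 < q)
    (h : BilBound Θ μ q d β γ K) (hG : LinBound Θ μ (q + 2) β G) :
    BilBound Θ μ q d γ β (K ^ (2 / q) * G ^ (1 - 2 / q)) := by
  intro u v a b ha hb hs
  have hq0 : 0 < q := by linarith
  have hα : 0 ≤ 2 / q := by positivity
  have hα' : 0 ≤ 1 - 2 / q := sub_nonneg.2 ((div_le_one hq0).2 hq.le)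
  have e1 : q * (2 / q) = 2 := by field_simp
  have e2 : 2 * (2 / q) + (q + 2) * (1 - 2 / q) = q := by field_simp; ring
  have e3 : q / 2 * (2 / q) = 1 := by field_simp
  have e4 : 2 / q + (q + 2) / 2 * (1 - 2 / q) = q / 2 := by field_simp; ring
  have hm : AEMeasurable (fun z => ‖expSum Θ b z‖ₑ ^ 2 * ‖expSum Θ a z‖ₑ ^ q) μ := by
    have h1 := (continuous_expSum Θ a).measurable
    have h2 := (continuous_expSum Θ b).measurable
    fun_prop
  calc ∫⁻ z, ‖expSum Θ a z‖ₑ ^ 2 * ‖expSum Θ b z‖ₑ ^ q ∂μ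
      = ∫⁻ z, (‖expSum Θ b z‖ₑ ^ 2 * ‖expSum Θ a z‖ₑ ^ q) ^ (2 / q) *
          (‖expSum Θ b z‖ₑ ^ (q + 2)) ^ (1 - 2 / q) ∂μ := by
        refine lintegral_congr fun z => ?_
        rw [ENNReal.mul_rpow_of_nonneg _ _ hα, ← ENNReal.rpow_two, ← ENNReal.rpow_two,
          ← ENNReal.rpow_mul, ← ENNReal.rpow_mul, ← ENNReal.rpow_mul, e1, mul_right_comm,
          ← ENNReal.rpow_add_of_nonneg _ _ (by positivity) (by positivity), e2, mul_comm]
    _ ≤ (∫⁻ z, ‖expSum Θ b z‖ₑ ^ 2 * ‖expSum Θ a z‖ₑ ^ q ∂μ) ^ (2 / q) *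
          (∫⁻ z, ‖expSum Θ b z‖ₑ ^ (q + 2) ∂μ) ^ (1 - 2 / q) :=
        ENNReal.lintegral_mul_norm_pow_le hm
          ((aemeasurable_enorm_expSum Θ μ b).pow_const _) hα hα' (by ring)
    _ ≤ (K * energy Θ b * energy Θ a ^ (q / 2)) ^ (2 / q) *
          (G * energy Θ b ^ ((q + 2) / 2)) ^ (1 - 2 / q) := by
        gcongr
        · exact h v u b a hb ha hs.symm
        · exact hG v b hb
    _ = K ^ (2 / q) * G ^ (1 - 2 / q) * energy Θ a *
          energy Θ b ^ (2 / q + (q + 2) / 2 * (1 - 2 / q)) := by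
        rw [ENNReal.mul_rpow_of_nonneg _ _ hα, ENNReal.mul_rpow_of_nonneg _ _ hα,
          ENNReal.mul_rpow_of_nonneg _ _ hα', ← ENNReal.rpow_mul, ← ENNReal.rpow_mul,
          ENNReal.rpow_add_of_nonneg _ _ hα (by positivity), e3, ENNReal.rpow_one]
        ring
    _ = _ := by rw [e4]

lemma AlmostInvariant.mono {μ : Measure (ℝ × ℝ)} {R R' : ℝ} {D : ℝ≥0∞}
    (h : AlmostInvariant μ R' D) (hR : R ≤ R') : AlmostInvariant μ R D :=
  fun v hv => h v (hv.trans hR)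

/-- The multiscale iteration: a power bound for single arcs improves in the bilinear setting. -/
lemma BilBound.iterate {Θ : Finset ℝ} {μ : Measure (ℝ × ℝ)} {q d δ A ε : ℝ} {D : ℝ≥0∞}
    (hq : 2 < q) (hd : 0 < d) (hδ : 0 < δ) (hA : 0 ≤ A) (hε : 0 ≤ ε) (hD : 1 ≤ D)
    (hdiam : ∀ θ ∈ Θ, ∀ φ ∈ Θ, |θ - φ| ≤ 1) (hμ : AlmostInvariant μ (1 / δ ^ 2) D)
    (hG : ∀ β, δ ≤ β → β ≤ d → LinBound Θ μ (q + 2) β (ENNReal.ofReal (A * (β / δ) ^ ε)))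
    (n : ℕ) : ∀ r : ℝ, 0 < r → r ≤ 1 → 3 * δ ≤ d * r ^ 2 ^ n → ∀ γ, BilBound Θ μ q d γ (d * r / 3)
      ((D * ENNReal.ofReal (Real.exp (2 * Real.pi)) ^ (q + 2)) ^ (n + 1) *
        ENNReal.ofReal (A * (d / (3 * δ)) ^ ε * r ^ (ε * (4 / q) ^ n))) := by
  set F := D * ENNReal.ofReal (Real.exp (2 * Real.pi)) ^ (q + 2) with hF
  have hF1 : 1 ≤ F := by
    refine one_le_mul hD (ENNReal.one_le_rpow ?_ (by linarith))
    rw [ENNReal.one_le_ofReal]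
    exact Real.one_le_exp (by positivity)
  have hG' : ∀ r : ℝ, 0 < r → r ≤ 1 → 3 * δ ≤ d * r →
      LinBound Θ μ (q + 2) (d * r / 3) (ENNReal.ofReal (A * (d / (3 * δ)) ^ ε * r ^ ε)) := by
    intro r hr hr1 h
    convert hG (d * r / 3) (by linarith) (by nlinarith) using 2
    rw [mul_assoc, ← Real.mul_rpow (by positivity) hr.le]
    congr 2
    field_simp
  have hshort : ∀ r : ℝ, 0 < r → r ≤ 1 → 3 * δ ≤ d * r → ∀ K,
      BilBound Θ μ q d (d * r ^ 2 / 3) (d * r / 3) K →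
      ∀ γ, BilBound Θ μ q d γ (d * r / 3) (F * K) := by
    intro r hr hr1 h K hK γ
    refine BilBound.of_short (by linarith) hd (by positivity) hdiam (hμ.mono ?_) ?_ γ
    · gcongr
      linarith
    · convert hK using 1
      field_simp
  induction n with
  | zero =>
    intro r hr hr1 h γ
    have h' : 3 * δ ≤ d * r := by simpa using h
    have := hshort r hr hr1 h' _ ((BilBound.of_linBound (by linarith) (hG' r hr hr1 h')
      d).mono_left (by nlinarith [mul_pos hd hr])) γ
    simpa using this
  | succ n ih =>
    intro r hr hr1 h γ
    have h1 : 3 * δ ≤ d * r := by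
      refine h.trans (mul_le_mul_of_nonneg_left ?_ hd.le)
      exact pow_le_of_le_one hr.le hr1 (by positivity)
    have h2 := ih (r ^ 2) (by positivity) (pow_le_one₀ hr.le hr1)
      (by rwa [← pow_mul, ← pow_succ']) (d * r / 3)
    have h3 := hshort r hr hr1 h1 _ (h2.swap hq (hG' r hr hr1 h1)) γ
    intro u v a b ha hb hs
    refine (h3 u v a b ha hb hs).trans ?_
    gcongr ?_ * _ * _
    have hq0 : 0 < q := by linarith
    have hα : 0 ≤ 2 / q := by positivity
    have hα1 : 2 / q ≤ 1 := (div_le_one hq0).2 hq.le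
    set B := A * (d / (3 * δ)) ^ ε with hB
    have hB0 : 0 ≤ B := by positivity
    have hreal : (B * (r ^ 2) ^ (ε * (4 / q) ^ n)) ^ (2 / q) * (B * r ^ ε) ^ (1 - 2 / q) ≤
        B * r ^ (ε * (4 / q) ^ (n + 1)) := by
      have e : (2 : ℝ) * (ε * (4 / q) ^ n) * (2 / q) = ε * (4 / q) ^ (n + 1) := by
        rw [pow_succ]; ring
      rw [← Real.rpow_natCast r 2, ← Real.rpow_mul hr.le, Real.mul_rpow hB0 (by positivity),
        Real.mul_rpow hB0 (by positivity), ← Real.rpow_mul hr.le, ← Real.rpow_mul hr.le,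
        mul_mul_mul_comm]
      push_cast
      rw [e]
      have hBB : B ^ (2 / q) * B ^ (1 - 2 / q) = B := by
        rw [← Real.rpow_add_of_nonneg hB0 hα (by linarith), add_sub_cancel, Real.rpow_one]
      rw [hBB]
      gcongr
      refine mul_le_of_le_one_right (by positivity) (Real.rpow_le_one hr.le hr1 ?_)
      exact mul_nonneg hε (by linarith)
    calc F * ((F ^ (n + 1) * ENNReal.ofReal (B * (r ^ 2) ^ (ε * (4 / q) ^ n))) ^ (2 / q) *
          ENNReal.ofReal (B * r ^ ε) ^ (1 - 2 / q))
        = F * (F ^ (n + 1)) ^ (2 / q) * ENNReal.ofReal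
          ((B * (r ^ 2) ^ (ε * (4 / q) ^ n)) ^ (2 / q) * (B * r ^ ε) ^ (1 - 2 / q)) := by
          rw [ENNReal.mul_rpow_of_nonneg _ _ hα,
            ENNReal.ofReal_rpow_of_nonneg (by positivity) hα,
            ENNReal.ofReal_rpow_of_nonneg (by positivity) (by linarith),
            ENNReal.ofReal_mul (p := (B * (r ^ 2) ^ (ε * (4 / q) ^ n)) ^ (2 / q)) (by positivity)]
          ring
      _ ≤ F * (F ^ (n + 1)) ^ (1 : ℝ) * ENNReal.ofReal (B * r ^ (ε * (4 / q) ^ (n + 1))) := by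
          gcongr
          exact one_le_pow₀ hF1
      _ = _ := by rw [ENNReal.rpow_one, ← pow_succ']

lemma suppIn_fiber {Θ : Finset ℝ} {c : ℝ → ℂ} {v l β : ℝ} (hβ : 0 < β) (h : SuppIn Θ c v l)
    (i : ℕ) : SuppIn Θ (fun θ => if ⌊(θ - v) / β⌋₊ = i then c θ else 0) (v + i * β) β := by
  intro θ hθ h0
  simp only [ne_eq, ite_eq_right_iff, Classical.not_imp] at h0
  have h1 : 0 ≤ (θ - v) / β := div_nonneg (by linarith [(h θ hθ h0.2).1]) hβ.le
  have h2 := (Nat.floor_eq_iff h1).1 h0.1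
  rw [le_div_iff₀ hβ, div_lt_iff₀ hβ] at h2
  constructor <;> nlinarith [h2.1, h2.2]

lemma floor_mem_range {Θ : Finset ℝ} {c : ℝ → ℂ} {v β : ℝ} (hβ : 0 < β) {m : ℕ}
    (h : SuppIn Θ c v (m * β)) : ∀ θ ∈ Θ, c θ ≠ 0 → ⌊(θ - v) / β⌋₊ ∈ Finset.range (m + 1) := by
  intro θ hθ h0
  rw [Finset.mem_range, Nat.lt_succ_iff]
  refine Nat.floor_le_of_le ?_
  rw [div_le_iff₀ hβ]
  linarith [(h θ hθ h0).2]

lemma energy_fiber_le {ι : Type*} [DecidableEq ι] (Θ : Finset ℝ) (c : ℝ → ℂ) (f : ℝ → ι) (i : ι) :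
    energy Θ (fun θ => if f θ = i then c θ else 0) ≤ energy Θ c := by
  refine energy_mono fun θ _ => ?_
  split_ifs <;> simp

lemma BilBound.of_split {Θ : Finset ℝ} {μ : Measure (ℝ × ℝ)} {q d γ β : ℝ} {K : ℝ≥0∞} (hq : 1 ≤ q)
    (hβ : 0 < β) (h : BilBound Θ μ q d γ β K) (m : ℕ) :
    BilBound Θ μ q d γ (m * β) (((m + 1 : ℕ) : ℝ≥0∞) ^ q * K) := by
  intro u v a b ha hb hs
  set b' : ℕ → ℝ → ℂ := fun i θ => if ⌊(θ - v) / β⌋₊ = i then b θ else 0 with hb'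
  have hbb' : ∀ i θ, b' i θ ≠ 0 → b θ ≠ 0 := by
    intro i θ h0
    simp only [hb', ne_eq, ite_eq_right_iff, Classical.not_imp] at h0
    exact h0.2
  set M : ℝ≥0∞ := ((m + 1 : ℕ) : ℝ≥0∞) with hM
  have hpt : ∀ z, ‖expSum Θ b z‖ₑ ^ q ≤
      M ^ (q - 1) * ∑ i ∈ Finset.range (m + 1), ‖expSum Θ (b' i) z‖ₑ ^ q := by
    intro z
    rw [← sum_expSum_fiber Θ b _ (floor_mem_range hβ hb)]
    have := ENNReal.rpow_sum_le_const_mul_sum_rpow (Finset.range (m + 1))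
      (fun i => ‖expSum Θ (b' i) z‖ₑ) hq
    rw [Finset.card_range] at this
    refine le_trans ?_ this
    gcongr
    exact enorm_sum_le _ _
  have hone : ∀ i, ∫⁻ z, ‖expSum Θ a z‖ₑ ^ 2 * ‖expSum Θ (b' i) z‖ₑ ^ q ∂μ ≤
      K * energy Θ a * energy Θ b ^ (q / 2) := by
    intro i
    refine (h u _ a (b' i) ha (suppIn_fiber hβ hb i)
      (hs.imp (fun h θ hθ φ hφ h0 h1 => h θ hθ φ hφ h0 (hbb' _ _ h1))
      (fun h θ hθ φ hφ h0 h1 => h θ hθ φ hφ h0 (hbb' _ _ h1)))).trans ?_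
    have : 0 ≤ q / 2 := by linarith
    gcongr
    exact energy_fiber_le _ _ _ _
  calc ∫⁻ z, ‖expSum Θ a z‖ₑ ^ 2 * ‖expSum Θ b z‖ₑ ^ q ∂μ
      ≤ ∫⁻ z, M ^ (q - 1) * ∑ i ∈ Finset.range (m + 1),
          ‖expSum Θ a z‖ₑ ^ 2 * ‖expSum Θ (b' i) z‖ₑ ^ q ∂μ := by
        refine lintegral_mono fun z => ?_
        rw [← Finset.mul_sum, mul_left_comm]
        gcongr
        exact hpt z
    _ = M ^ (q - 1) * ∑ i ∈ Finset.range (m + 1),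
          ∫⁻ z, ‖expSum Θ a z‖ₑ ^ 2 * ‖expSum Θ (b' i) z‖ₑ ^ q ∂μ := by
        have hm : ∀ i, Measurable fun z => ‖expSum Θ a z‖ₑ ^ 2 * ‖expSum Θ (b' i) z‖ₑ ^ q := by
          intro i
          have h1 := (continuous_expSum Θ a).measurable
          have h2 := (continuous_expSum Θ (b' i)).measurable
          fun_prop
        rw [lintegral_const_mul _ (Finset.measurable_fun_sum _ fun i _ => hm i),
          lintegral_finsetSum _ fun i _ => hm i]
    _ ≤ M ^ (q - 1) * ∑ i ∈ Finset.range (m + 1), K * energy Θ a * energy Θ b ^ (q / 2) := by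
        gcongr
        exact hone _
    _ = M ^ (q - 1) * M ^ (1 : ℝ) * (K * energy Θ a * energy Θ b ^ (q / 2)) := by
        rw [Finset.sum_const, Finset.card_range, nsmul_eq_mul, ENNReal.rpow_one, hM]
        ring
    _ = _ := by
        rw [← ENNReal.rpow_add_of_nonneg _ _ (by linarith) (by norm_num), sub_add_cancel]
        ring

lemma enorm_sum_rpow_le_broad_narrow (x : ℕ → ℂ) (n : ℕ) {q : ℝ} (hq : 0 < q) :
    ‖∑ i ∈ Finset.range n, x i‖ₑ ^ (q + 2) ≤
      6 ^ (q + 2) * ∑ i ∈ Finset.range n, ‖x i‖ₑ ^ (q + 2) +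
      (2 * n) ^ (q + 2) * ∑ i ∈ Finset.range n, ∑ j ∈ Finset.range n,
        if i + 2 ≤ j ∨ j + 2 ≤ i then ‖x i‖ₑ ^ 2 * ‖x j‖ₑ ^ q else 0 := by
  rcases Nat.eq_zero_or_pos n with rfl | hn
  · simp only [Finset.range_zero, Finset.sum_empty, enorm_zero]
    rw [ENNReal.zero_rpow_of_pos (by linarith)]
    exact zero_le
  obtain ⟨k, hk, hmax⟩ := Finset.exists_max_image (Finset.range n) (fun i => ‖x i‖)
    ⟨0, Finset.mem_range.2 hn⟩
  set S := ‖∑ i ∈ Finset.range n, x i‖ with hS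
  have hn0 : (0 : ℝ) < n := by exact_mod_cast hn
  have hconv : ∀ i (C : ℕ), S ≤ C * ‖x i‖ →
      ‖∑ i ∈ Finset.range n, x i‖ₑ ≤ C * ‖x i‖ₑ := by
    intro i C h
    rw [← ofReal_norm, ← ofReal_norm, ← ENNReal.ofReal_natCast, ← ENNReal.ofReal_mul (by simp)]
    exact ENNReal.ofReal_le_ofReal h
  by_cases hfar : ∃ i ∈ Finset.range n, (i + 2 ≤ k ∨ k + 2 ≤ i) ∧ S < 2 * n * ‖x i‖
  · obtain ⟨i, hi, hik, hSi⟩ := hfar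
    have h1 := hconv i (2 * n) (by push_cast; exact hSi.le)
    have h2 := hconv k (2 * n) (by
      push_cast; exact hSi.le.trans (mul_le_mul_of_nonneg_left (hmax i hi) (by positivity)))
    push_cast at h1 h2
    refine le_add_left ?_
    calc ‖∑ i ∈ Finset.range n, x i‖ₑ ^ (q + 2)
        = ‖∑ i ∈ Finset.range n, x i‖ₑ ^ (2 : ℝ) * ‖∑ i ∈ Finset.range n, x i‖ₑ ^ q := by
          rw [add_comm, ENNReal.rpow_add_of_nonneg _ _ (by norm_num) hq.le]
      _ ≤ (2 * n * ‖x i‖ₑ) ^ (2 : ℝ) * (2 * n * ‖x k‖ₑ) ^ q := by gcongr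
      _ = (2 * n) ^ (q + 2) * (if i + 2 ≤ k ∨ k + 2 ≤ i then ‖x i‖ₑ ^ 2 * ‖x k‖ₑ ^ q else 0) := by
          rw [if_pos hik, ENNReal.mul_rpow_of_nonneg _ _ (by norm_num),
            ENNReal.mul_rpow_of_nonneg _ _ hq.le,
            ENNReal.rpow_add_of_nonneg _ _ hq.le (by norm_num), ENNReal.rpow_two ‖x i‖ₑ]
          ring
      _ ≤ _ := by
          gcongr
          exact (Finset.single_le_sum (f := fun j => if i + 2 ≤ j ∨ j + 2 ≤ i then
            ‖x i‖ₑ ^ 2 * ‖x j‖ₑ ^ q else 0) (fun _ _ => zero_le) hk).trans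
            (Finset.single_le_sum (f := fun i => ∑ j ∈ Finset.range n,
              if i + 2 ≤ j ∨ j + 2 ≤ i then ‖x i‖ₑ ^ 2 * ‖x j‖ₑ ^ q else 0)
              (fun _ _ => zero_le) hi)
  · push Not at hfar
    have h1 : S ≤ (6 : ℕ) * ‖x k‖ := by
      have h2 : ∀ i ∈ Finset.range n,
          ‖x i‖ ≤ S / (2 * n) + if i ∈ Finset.Icc (k - 1) (k + 1) then ‖x k‖ else 0 := by
        intro i hi
        split_ifs with h
        · linarith [hmax i hi, show 0 ≤ S / (2 * n) by positivity]
        · rw [add_zero, le_div_iff₀ (by positivity), mul_comm]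
          refine hfar i hi ?_
          rw [Finset.mem_Icc] at h
          omega
      have h3 : S ≤ S / 2 + 3 * ‖x k‖ := by
        calc S ≤ ∑ i ∈ Finset.range n, ‖x i‖ := norm_sum_le _ _
          _ ≤ ∑ i ∈ Finset.range n,
              (S / (2 * n) + if i ∈ Finset.Icc (k - 1) (k + 1) then ‖x k‖ else 0) :=
              Finset.sum_le_sum h2
          _ = S / 2 + ∑ i ∈ Finset.range n with i ∈ Finset.Icc (k - 1) (k + 1), ‖x k‖ := by
              rw [Finset.sum_add_distrib, Finset.sum_filter, Finset.sum_const, Finset.card_range,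
                nsmul_eq_mul]
              congr 1
              field_simp
          _ ≤ S / 2 + 3 * ‖x k‖ := by
              rw [Finset.sum_const, nsmul_eq_mul]
              gcongr
              have : (Finset.filter (· ∈ Finset.Icc (k - 1) (k + 1)) (Finset.range n)).card ≤
                  (Finset.Icc (k - 1) (k + 1)).card :=
                Finset.card_le_card fun i hi => (Finset.mem_filter.1 hi).2
              rw [Nat.card_Icc] at this
              exact_mod_cast this.trans (by omega)
      push_cast
      linarith
    refine le_add_right ?_
    calc ‖∑ i ∈ Finset.range n, x i‖ₑ ^ (q + 2) ≤ (6 * ‖x k‖ₑ) ^ (q + 2) := by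
          gcongr
          exact_mod_cast hconv k 6 h1
      _ = 6 ^ (q + 2) * ‖x k‖ₑ ^ (q + 2) := ENNReal.mul_rpow_of_nonneg _ _ (by linarith)
      _ ≤ _ := by
          gcongr
          exact Finset.single_le_sum (f := fun i => ‖x i‖ₑ ^ (q + 2)) (fun _ _ => zero_le) hk

lemma sum_energy_fiber_rpow_le {ι : Type*} [DecidableEq ι] (Θ : Finset ℝ) (c : ℝ → ℂ) (f : ℝ → ι)
    {S : Finset ι} (hf : ∀ θ ∈ Θ, c θ ≠ 0 → f θ ∈ S) {s : ℝ} (hs : 1 ≤ s) :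
    ∑ j ∈ S, energy Θ (fun θ => if f θ = j then c θ else 0) ^ s ≤ energy Θ c ^ s := by
  have e : ∀ x : ℝ≥0∞, x ^ s = x * x ^ (s - 1) := by
    intro x
    conv_lhs => rw [show s = 1 + (s - 1) by ring]
    rw [ENNReal.rpow_add_of_nonneg _ _ (by norm_num) (by linarith), ENNReal.rpow_one]
  rw [e (energy Θ c)]
  nth_rw 1 [← sum_energy_fiber Θ c f hf]
  rw [Finset.sum_mul]
  refine Finset.sum_le_sum fun j _ => ?_
  rw [e]
  have : 0 ≤ s - 1 := by linarith
  gcongr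
  exact energy_fiber_le _ _ _ _

lemma LinBound.of_broad_narrow {Θ : Finset ℝ} {μ : Measure (ℝ × ℝ)} {q β : ℝ} {K₁ K₂ : ℝ≥0∞}
    (hq : 0 < q) (hβ : 0 < β) (h₁ : LinBound Θ μ (q + 2) β K₁) (h₂ : BilBound Θ μ q β β β K₂)
    (m : ℕ) : LinBound Θ μ (q + 2) (m * β) (6 ^ (q + 2) * K₁ +
      (2 * (m + 1 : ℕ)) ^ (q + 2) * ((m + 1 : ℕ) : ℝ≥0∞) ^ 2 * K₂) := by
  intro u c hc
  set f : ℝ → ℕ := fun θ => ⌊(θ - u) / β⌋₊ with hf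
  set c' : ℕ → ℝ → ℂ := fun i θ => if f θ = i then c θ else 0 with hc'
  have hmem := floor_mem_range hβ hc
  have hcc' : ∀ i θ, c' i θ ≠ 0 → f θ = i ∧ c θ ≠ 0 := by
    intro i θ h0
    simp only [hc', ne_eq, ite_eq_right_iff, Classical.not_imp] at h0
    exact h0
  set R := Finset.range (m + 1) with hR
  have hm1 : ∀ i, Measurable fun z => ‖expSum Θ (c' i) z‖ₑ ^ (q + 2) := fun i =>
    (continuous_expSum Θ (c' i)).measurable.enorm.pow_const _
  have hm2 : ∀ i j, Measurable fun z => if i + 2 ≤ j ∨ j + 2 ≤ i then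
      ‖expSum Θ (c' i) z‖ₑ ^ 2 * ‖expSum Θ (c' j) z‖ₑ ^ q else 0 := by
    intro i j
    have h1 := (continuous_expSum Θ (c' i)).measurable
    have h2 := (continuous_expSum Θ (c' j)).measurable
    split_ifs <;> fun_prop
  have hone : ∀ i j, ∫⁻ z, (if i + 2 ≤ j ∨ j + 2 ≤ i then
      ‖expSum Θ (c' i) z‖ₑ ^ 2 * ‖expSum Θ (c' j) z‖ₑ ^ q else 0) ∂μ ≤
      K₂ * energy Θ c ^ ((q + 2) / 2) := by
    intro i j
    split_ifs with hij
    · have hlt : ∀ i j : ℕ, i + 2 ≤ j → ∀ θ ∈ Θ, ∀ φ ∈ Θ, c' i θ ≠ 0 → c' j φ ≠ 0 →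
          θ + β ≤ φ := by
        intro i j hij θ hθ φ hφ h0 h1
        have h2 := (suppIn_fiber hβ hc i θ hθ h0).2
        have h3 := (suppIn_fiber hβ hc j φ hφ h1).1
        have h4 : (i : ℝ) + 2 ≤ j := by exact_mod_cast hij
        nlinarith
      refine (h₂ _ _ (c' i) (c' j) (suppIn_fiber hβ hc i) (suppIn_fiber hβ hc j)
        (hij.imp (hlt i j) fun h θ hθ φ hφ h0 h1 => hlt j i h φ hφ θ hθ h1 h0)).trans ?_
      rw [add_div, div_self (two_ne_zero' ℝ), add_comm (q / 2),
        ENNReal.rpow_add_of_nonneg _ _ (by norm_num) (by positivity), ENNReal.rpow_one, ← mul_assoc]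
      gcongr <;> exact energy_fiber_le _ _ _ _
    · simp
  calc ∫⁻ z, ‖expSum Θ c z‖ₑ ^ (q + 2) ∂μ
      ≤ ∫⁻ z, (6 ^ (q + 2) * ∑ i ∈ R, ‖expSum Θ (c' i) z‖ₑ ^ (q + 2) +
        (2 * (m + 1 : ℕ)) ^ (q + 2) * ∑ i ∈ R, ∑ j ∈ R, if i + 2 ≤ j ∨ j + 2 ≤ i then
          ‖expSum Θ (c' i) z‖ₑ ^ 2 * ‖expSum Θ (c' j) z‖ₑ ^ q else 0) ∂μ := by
        refine lintegral_mono fun z => ?_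
        rw [← sum_expSum_fiber Θ c f hmem z]
        exact enorm_sum_rpow_le_broad_narrow _ _ hq
    _ = 6 ^ (q + 2) * ∑ i ∈ R, ∫⁻ z, ‖expSum Θ (c' i) z‖ₑ ^ (q + 2) ∂μ +
        (2 * (m + 1 : ℕ)) ^ (q + 2) * ∑ i ∈ R, ∑ j ∈ R, ∫⁻ z, (if i + 2 ≤ j ∨ j + 2 ≤ i then
          ‖expSum Θ (c' i) z‖ₑ ^ 2 * ‖expSum Θ (c' j) z‖ₑ ^ q else 0) ∂μ := by
        have m1 := Finset.measurable_fun_sum R fun i _ => hm1 i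
        have m2 : ∀ i, _ := fun i => Finset.measurable_fun_sum R fun j _ => hm2 i j
        have m3 := Finset.measurable_fun_sum R fun i _ => m2 i
        rw [lintegral_add_left (m1.const_mul _), lintegral_const_mul _ m1, lintegral_const_mul _ m3,
          lintegral_finsetSum _ fun i _ => hm1 i, lintegral_finsetSum _ fun i _ => m2 i]
        congr 2
        exact Finset.sum_congr rfl fun i _ => lintegral_finsetSum _ fun j _ => hm2 i j
    _ ≤ 6 ^ (q + 2) * ∑ i ∈ R, K₁ * energy Θ (c' i) ^ ((q + 2) / 2) +
        (2 * (m + 1 : ℕ)) ^ (q + 2) * ∑ i ∈ R, ∑ j ∈ R, K₂ * energy Θ c ^ ((q + 2) / 2) := by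
        gcongr with i _ i _ j _
        · exact h₁ _ (c' i) (suppIn_fiber hβ hc i)
        · exact hone i j
    _ ≤ 6 ^ (q + 2) * (K₁ * energy Θ c ^ ((q + 2) / 2)) +
        (2 * (m + 1 : ℕ)) ^ (q + 2) *
          (((m + 1 : ℕ) : ℝ≥0∞) ^ 2 * (K₂ * energy Θ c ^ ((q + 2) / 2))) := by
        rw [← Finset.mul_sum]
        gcongr
        · exact sum_energy_fiber_rpow_le Θ c f hmem (by linarith)
        · rw [Finset.sum_const, Finset.sum_const, hR, Finset.card_range, nsmul_eq_mul,
            nsmul_eq_mul, ← mul_assoc, sq]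
    _ = _ := by ring

lemma LinBound.of_separated {Θ : Finset ℝ} {δ : ℝ} (hδ : 0 < δ)
    (hsep : ∀ θ ∈ Θ, ∀ φ ∈ Θ, θ ≠ φ → δ ≤ |θ - φ|) (μ : Measure (ℝ × ℝ)) {p β : ℝ} (hp : 0 ≤ p)
    {n : ℕ} (hn : β ≤ n * δ) :
    LinBound Θ μ p β (((n + 1 : ℕ) : ℝ≥0∞) ^ (p / 2) * μ Set.univ) := by
  intro u c hc
  set S := Θ.filter fun θ => c θ ≠ 0 with hS
  have hcard : S.card ≤ n + 1 := by
    rw [← Finset.card_range (n + 1)]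
    refine Finset.card_le_card_of_injOn (fun θ => ⌊(θ - u) / δ⌋₊) ?_ ?_
    · intro θ hθ
      obtain ⟨h1, h2⟩ := Finset.mem_filter.1 hθ
      exact floor_mem_range hδ (hc.mono hn) θ h1 h2
    · intro θ hθ φ hφ h
      obtain ⟨h1, h2⟩ := Finset.mem_filter.1 hθ
      obtain ⟨h3, h4⟩ := Finset.mem_filter.1 hφ
      by_contra hne
      have h5 := hsep θ h1 φ h3 hne
      have h6 : 0 ≤ (θ - u) / δ := div_nonneg (by linarith [(hc θ h1 h2).1]) hδ.le
      have h7 : 0 ≤ (φ - u) / δ := div_nonneg (by linarith [(hc φ h3 h4).1]) hδ.le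
      have h8 := (Nat.floor_eq_iff h6).1 h
      have h9 := (Nat.floor_eq_iff h7).1 rfl
      simp only [le_div_iff₀ hδ, div_lt_iff₀ hδ] at h8 h9
      rcases le_abs.1 h5 with h5 | h5 <;> nlinarith [h8.1, h8.2, h9.1, h9.2]
  have hpt : ∀ z, ‖expSum Θ c z‖ₑ ^ p ≤ ((n + 1 : ℕ) : ℝ≥0∞) ^ (p / 2) * energy Θ c ^ (p / 2) := by
    intro z
    have h1 : ‖expSum Θ c z‖ₑ ≤ ∑ θ ∈ S, ‖c θ‖ₑ := by
      rw [expSum, ← Finset.sum_filter_of_ne (p := fun θ => c θ ≠ 0)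
        fun θ _ h => left_ne_zero_of_mul h]
      refine (enorm_sum_le _ _).trans_eq (Finset.sum_congr rfl fun θ _ => ?_)
      have : wave θ z = Complex.exp
          (((2 * Real.pi * (Real.cos θ * z.1 + Real.sin θ * z.2) : ℝ) : ℂ) * Complex.I) := by
        rw [wave]
        congr 1
        push_cast
        ring
      rw [enorm_mul, this, ← ofReal_norm (Complex.exp _), Complex.norm_exp_ofReal_mul_I,
        ENNReal.ofReal_one, mul_one]
    have h2 := ENNReal.rpow_sum_le_const_mul_sum_rpow S (fun θ => ‖c θ‖ₑ) (p := 2) (by norm_num)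
    have h3 : ‖expSum Θ c z‖ₑ ^ (2 : ℝ) ≤ ((n + 1 : ℕ) : ℝ≥0∞) * energy Θ c := by
      refine (ENNReal.rpow_le_rpow h1 (by norm_num)).trans (h2.trans ?_)
      rw [show (2 : ℝ) - 1 = 1 by norm_num, ENNReal.rpow_one]
      simp_rw [ENNReal.rpow_two]
      gcongr
      exact Finset.sum_le_sum_of_subset (Finset.filter_subset _ _)
    rw [← ENNReal.mul_rpow_of_nonneg _ _ (by positivity), show p = 2 * (p / 2) by ring,
      ENNReal.rpow_mul, ← show p = 2 * (p / 2) by ring]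
    gcongr
  calc ∫⁻ z, ‖expSum Θ c z‖ₑ ^ p ∂μ
      ≤ ∫⁻ _, ((n + 1 : ℕ) : ℝ≥0∞) ^ (p / 2) * energy Θ c ^ (p / 2) ∂μ := lintegral_mono hpt
    _ = _ := by rw [lintegral_const]; ring

lemma LinBound.mono {Θ : Finset ℝ} {μ : Measure (ℝ × ℝ)} {p β : ℝ} {K K' : ℝ≥0∞}
    (h : LinBound Θ μ p β K) (hK : K ≤ K') : LinBound Θ μ p β K' :=
  fun u c hc => (h u c hc).trans (by gcongr)

/-- Induction on scales. -/
lemma LinBound.of_scales {Θ : Finset ℝ} {μ : Measure (ℝ × ℝ)} {q δ A ε : ℝ} {D : ℝ≥0∞} {m n : ℕ}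
    (hq : 2 < q) (hq4 : q ≤ 4) (hδ : 0 < δ) (hA : 0 ≤ A) (hε : 0 ≤ ε) (hD : 1 ≤ D)
    (hdiam : ∀ θ ∈ Θ, ∀ φ ∈ Θ, |θ - φ| ≤ 1)
    (hsep : ∀ θ ∈ Θ, ∀ φ ∈ Θ, θ ≠ φ → δ ≤ |θ - φ|) (hμ : AlmostInvariant μ (1 / δ ^ 2) D)
    (hm : 2 ≤ m)
    (hstep : 6 ^ (q + 2) * ENNReal.ofReal ((m : ℝ)⁻¹ ^ ε) +
      (2 * (m + 1 : ℕ)) ^ (q + 2) * ((m + 1 : ℕ) : ℝ≥0∞) ^ 2 * (((3 * m + 1 : ℕ) : ℝ≥0∞) ^ q *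
        ((D * ENNReal.ofReal (Real.exp (2 * Real.pi)) ^ (q + 2)) ^ (n + 1) *
          ENNReal.ofReal ((m : ℝ)⁻¹ ^ (ε * (4 / q) ^ n)))) ≤ 1)
    (hbase : ((3 * m ^ (2 ^ n + 1) + 1 : ℕ) : ℝ≥0∞) ^ (3 : ℝ) * μ Set.univ ≤ ENNReal.ofReal A)
    {η : ℝ} (hη : δ ≤ η) : LinBound Θ μ (q + 2) η (ENNReal.ofReal (A * (η / δ) ^ ε)) := by
  have hm0 : (0 : ℝ) < m := by positivity
  have hm1 : (1 : ℝ) < m := by exact_mod_cast hm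
  set F := D * ENNReal.ofReal (Real.exp (2 * Real.pi)) ^ (q + 2) with hF
  set N := 3 * m ^ (2 ^ n + 1) with hN
  have hsmall : ∀ η, δ ≤ η → η ≤ δ * N →
      LinBound Θ μ (q + 2) η (ENNReal.ofReal (A * (η / δ) ^ ε)) := by
    intro η hη h
    refine (LinBound.of_separated hδ hsep μ (by linarith) (h.trans_eq (mul_comm _ _))).mono ?_
    calc ((N + 1 : ℕ) : ℝ≥0∞) ^ ((q + 2) / 2) * μ Set.univ
        ≤ ((N + 1 : ℕ) : ℝ≥0∞) ^ (3 : ℝ) * μ Set.univ := by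
          gcongr
          · exact_mod_cast Nat.succ_pos N
          · linarith
      _ ≤ ENNReal.ofReal A := hbase
      _ ≤ _ := by
          refine ENNReal.ofReal_le_ofReal (le_mul_of_one_le_right hA ?_)
          exact Real.one_le_rpow ((one_le_div hδ).2 hη) hε
  have key : ∀ k : ℕ, ∀ η, δ ≤ η → η ≤ δ * N * m ^ k →
      LinBound Θ μ (q + 2) η (ENNReal.ofReal (A * (η / δ) ^ ε)) := by
    intro k
    induction k with
    | zero => simpa using hsmall
    | succ k ih =>
      intro η hη h
      rcases le_or_gt η (δ * N) with hs | hs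
      · exact hsmall η hη hs
      have hη0 : 0 < η := hδ.trans_le hη
      set d := η / m with hd
      have hd0 : 0 < d := by positivity
      have hmd : m * d = η := by rw [hd]; field_simp
      have hdle : d ≤ δ * N * m ^ k := by
        rw [hd, div_le_iff₀ hm0, mul_assoc, ← pow_succ]
        exact h
      have hNd : 3 * δ ≤ d * (m : ℝ)⁻¹ ^ 2 ^ n := by
        rw [inv_pow, ← div_eq_mul_inv, hd, div_div, le_div_iff₀ (by positivity), ← pow_succ']
        refine le_trans (le_of_eq ?_) hs.le
        rw [hN]
        push_cast
        ring
      have hδd : δ ≤ d := by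
        have : d * (m : ℝ)⁻¹ ^ 2 ^ n ≤ d :=
          mul_le_of_le_one_right hd0.le (pow_le_one₀ (by positivity) (inv_le_one_of_one_le₀ hm1.le))
        linarith
      set U := ENNReal.ofReal (A * (η / δ) ^ ε) with hU
      have h1 : LinBound Θ μ (q + 2) d (U * ENNReal.ofReal ((m : ℝ)⁻¹ ^ ε)) := by
        refine (ih d hδd hdle).mono (le_of_eq ?_)
        rw [hU, ← ENNReal.ofReal_mul (by positivity), mul_assoc, ← Real.mul_rpow (by positivity)
          (by positivity), hd]
        congr 3
        field_simp
      have h2 := (BilBound.iterate hq hd0 hδ hA hε hD hdiam hμ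
        (fun β hβ hβd => ih β hβ (hβd.trans hdle)) n (m : ℝ)⁻¹ (by positivity)
        (inv_le_one_of_one_le₀ hm1.le) hNd d).of_split (by linarith) (by positivity) (3 * m)
      have e : ((3 * m : ℕ) : ℝ) * (d * (m : ℝ)⁻¹ / 3) = d := by
        push_cast
        field_simp
      rw [e] at h2
      have h3 := LinBound.of_broad_narrow (by linarith) hd0 h1 h2 m
      rw [hmd] at h3
      refine h3.mono ?_
      have hK : ENNReal.ofReal (A * (d / (3 * δ)) ^ ε * (m : ℝ)⁻¹ ^ (ε * (4 / q) ^ n)) ≤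
          U * ENNReal.ofReal ((m : ℝ)⁻¹ ^ (ε * (4 / q) ^ n)) := by
        rw [hU, ← ENNReal.ofReal_mul (by positivity)]
        refine ENNReal.ofReal_le_ofReal ?_
        have h4 : d ≤ η := div_le_self hη0.le hm1.le
        gcongr
        linarith
      calc _ ≤ 6 ^ (q + 2) * (U * ENNReal.ofReal ((m : ℝ)⁻¹ ^ ε)) +
            (2 * (m + 1 : ℕ)) ^ (q + 2) * ((m + 1 : ℕ) : ℝ≥0∞) ^ 2 *
            (((3 * m + 1 : ℕ) : ℝ≥0∞) ^ q * (F ^ (n + 1) *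
              (U * ENNReal.ofReal ((m : ℝ)⁻¹ ^ (ε * (4 / q) ^ n))))) := by gcongr
        _ = U * (6 ^ (q + 2) * ENNReal.ofReal ((m : ℝ)⁻¹ ^ ε) +
            (2 * (m + 1 : ℕ)) ^ (q + 2) * ((m + 1 : ℕ) : ℝ≥0∞) ^ 2 *
            (((3 * m + 1 : ℕ) : ℝ≥0∞) ^ q * (F ^ (n + 1) *
              ENNReal.ofReal ((m : ℝ)⁻¹ ^ (ε * (4 / q) ^ n))))) := by ring
        _ ≤ U * 1 := by gcongr
        _ = U := mul_one U
  obtain ⟨k, hk⟩ := pow_unbounded_of_one_lt (η / (δ * N)) hm1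
  have hN0 : (0 : ℝ) < N := by rw [hN]; positivity
  refine key k η hη ?_
  rw [div_lt_iff₀ (by positivity)] at hk
  linarith

lemma exists_scale_parameters {κ Λ q : ℝ} (hκ : 0 ≤ κ) (hΛ : 1 ≤ Λ) (hq : 2 < q) (hq4 : q < 4) :
    ∃ m n : ℕ, ∃ ε : ℝ, 2 ≤ m ∧ 0 ≤ ε ∧ 12 ≤ ε * Real.log m ∧
      23 + 12 * Real.log m + κ * (n + 1) ≤ ε * (4 / q) ^ n * Real.log m ∧
      ε * Λ ≤ (47 + 2 * κ) * Λ ^ (1 - 1 / 4 * (1 - Real.logb 2 (q / 2))) ∧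
      (2 ^ n + 1) * Real.log m ≤ 6 * Λ ^ (1 - 1 / 4 * (1 - Real.logb 2 (q / 2))) := by
  have hΛ0 : 0 < Λ := by linarith
  have hq0 : 0 < q := by linarith
  set X := Λ ^ (1 / 4 : ℝ) with hX
  have hX1 : 1 ≤ X := Real.one_le_rpow hΛ (by norm_num)
  have hX0 : 0 < X := by linarith
  set τ := Real.logb 2 (q / 2) with hτ
  have hτ0 : 0 ≤ τ := Real.logb_nonneg (by norm_num) (by linarith)
  have hτ1 : τ ≤ 1 := by
    rw [hτ, Real.logb_le_iff_le_rpow (by norm_num) (by positivity), Real.rpow_one]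
    linarith
  set σ := 1 / 4 * (1 - τ) with hσ
  obtain ⟨n, hn1, hn2⟩ : ∃ n : ℕ, X ≤ 2 ^ n ∧ (2 : ℝ) ^ n ≤ 2 * X := by
    obtain ⟨n, h1, h2⟩ := exists_nat_pow_near hX1 (one_lt_two (α := ℝ))
    exact ⟨n + 1, h2.le, by rw [pow_succ']; linarith⟩
  set m := ⌈Real.exp X⌉₊ with hm
  have hexp : 1 < Real.exp X := Real.one_lt_exp_iff.2 hX0
  have hm2 : 2 ≤ m := by
    have : (1 : ℝ) < m := hexp.trans_le (Nat.le_ceil _)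
    exact_mod_cast this
  have hm0 : (0 : ℝ) < m := by positivity
  have hℓ1 : X ≤ Real.log m := (Real.le_log_iff_exp_le hm0).2 (Nat.le_ceil _)
  have hℓ2 : Real.log m ≤ X + 1 := by
    rw [Real.log_le_iff_le_exp hm0, Real.exp_add]
    have h1 := Nat.ceil_lt_add_one (Real.exp_pos X).le
    have h2 := Real.add_one_le_exp (1 : ℝ)
    nlinarith
  set ℓ := Real.log m with hℓ
  have hℓ0 : 0 < ℓ := by linarith
  set s := (4 / q) ^ n with hs
  have hs0 : 0 < s := by positivity
  have hsX : Λ ^ σ ≤ s := by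
    have e : (4 / q : ℝ) = 2 ^ (1 - τ) := by
      rw [hτ, Real.rpow_sub (by norm_num), Real.rpow_logb (by norm_num) (by norm_num)
        (by positivity), Real.rpow_one]
      field_simp
      norm_num
    rw [hs, e, ← Real.rpow_natCast, ← Real.rpow_mul (by norm_num), mul_comm (1 - τ),
      Real.rpow_mul (x := 2) (by norm_num), Real.rpow_natCast, hσ, Real.rpow_mul hΛ0.le (1 / 4) (1 - τ)]
    exact Real.rpow_le_rpow hX0.le hn1 (by linarith)
  have hn3 : (n : ℝ) + 1 ≤ 2 ^ n := by exact_mod_cast Nat.lt_two_pow_self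
  refine ⟨m, n, 12 / ℓ + (23 + 12 * ℓ + κ * (n + 1)) / (s * ℓ), hm2, by positivity, ?_, ?_, ?_, ?_⟩
  · rw [add_mul, div_mul_cancel₀ _ hℓ0.ne']
    exact le_add_of_nonneg_right (by positivity)
  · rw [mul_assoc, add_mul, div_mul_cancel₀ _ (by positivity)]
    exact le_add_of_nonneg_left (by positivity)
  · have h1 : 12 / ℓ ≤ 12 * Λ ^ (-σ) := by
      rw [div_eq_mul_inv]
      gcongr
      calc ℓ⁻¹ ≤ X⁻¹ := by gcongr
        _ = Λ ^ (-(1 / 4 : ℝ)) := by rw [hX, Real.rpow_neg hΛ0.le]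
        _ ≤ Λ ^ (-σ) := Real.rpow_le_rpow_of_exponent_le hΛ (by rw [hσ]; linarith)
    have h2 : (23 + 12 * ℓ + κ * (n + 1)) / (s * ℓ) ≤ (35 + 2 * κ) * Λ ^ (-σ) := by
      rw [Real.rpow_neg hΛ0.le, ← div_eq_mul_inv]
      rw [div_le_div_iff₀ (by positivity) (by positivity)]
      have h3 : 23 + 12 * ℓ + κ * (n + 1) ≤ (35 + 2 * κ) * ℓ := by nlinarith
      calc _ ≤ ((35 + 2 * κ) * ℓ) * s := by gcongr
        _ = _ := by ring
    rw [sub_eq_add_neg, Real.rpow_add hΛ0, Real.rpow_one]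
    calc _ ≤ (12 * Λ ^ (-σ) + (35 + 2 * κ) * Λ ^ (-σ)) * Λ := by gcongr
      _ = _ := by ring
  · calc (2 ^ n + 1) * ℓ ≤ (2 * X + 1) * (X + 1) := by gcongr
      _ ≤ 6 * (X * X) := by nlinarith
      _ = 6 * Λ ^ (1 / 4 + 1 / 4 : ℝ) := by rw [Real.rpow_add hΛ0]
      _ ≤ _ := by
        gcongr
        linarith

lemma two_pow_le_exp (k : ℕ) : (2 : ℝ) ^ k ≤ Real.exp k := by
  rw [← Real.exp_one_pow k]
  gcongr
  linarith [Real.add_one_le_exp (1 : ℝ)]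

/-- Discrete restriction for angles in an arc of length one. -/
lemma linBound_one {Θ : Finset ℝ} {μ : Measure (ℝ × ℝ)} {q δ κ : ℝ} {D : ℝ≥0∞}
    (hq : 2 < q) (hq4 : q < 4) (hδ : 0 < δ) (hδ1 : 1 ≤ Real.log (1 / δ)) (hκ : 0 ≤ κ)
    (hD : 1 ≤ D) (hDκ : D ≤ ENNReal.ofReal (Real.exp κ))
    (hμκ : μ Set.univ ≤ ENNReal.ofReal (Real.exp κ))
    (hdiam : ∀ θ ∈ Θ, ∀ φ ∈ Θ, |θ - φ| ≤ 1)
    (hsep : ∀ θ ∈ Θ, ∀ φ ∈ Θ, θ ≠ φ → δ ≤ |θ - φ|) (hμ : AlmostInvariant μ (1 / δ ^ 2) D) :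
    LinBound Θ μ (q + 2) 1 (ENNReal.ofReal (Real.exp ((71 + 3 * κ + 24 * Real.pi) *
      Real.log (1 / δ) ^ (1 - 1 / 4 * (1 - Real.logb 2 (q / 2)))))) := by
  have hpi := Real.pi_pos
  obtain ⟨m, n, ε, hm, hε, h1, h2, h3, h4⟩ :=
    exists_scale_parameters (κ := κ + 12 * Real.pi) (by positivity) hδ1 hq hq4
  set Λ := Real.log (1 / δ) with hΛ
  have hm0 : (0 : ℝ) < m := by positivity
  set W := Λ ^ (1 - 1 / 4 * (1 - Real.logb 2 (q / 2))) with hW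
  have hW1 : 1 ≤ W := by
    refine Real.one_le_rpow hδ1 ?_
    have := Real.logb_nonneg (b := 2) (x := q / 2) (by norm_num) (by linarith)
    linarith
  have hexp : (m : ℝ) = Real.exp (Real.log m) := (Real.exp_log hm0).symm
  have hδ2 : δ ≤ 1 := by
    have : 0 < Real.log (1 / δ) := by linarith
    rw [one_div, Real.log_inv] at this
    exact (Real.log_nonpos_iff hδ.le).1 (by linarith)
  have hpow : ∀ x : ℝ, (m : ℝ)⁻¹ ^ x = Real.exp (-(x * Real.log m)) := by
    intro x
    rw [Real.inv_rpow hm0.le, Real.rpow_def_of_pos hm0, ← Real.exp_neg, mul_comm]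
  have hmR : (2 : ℝ) ≤ m := by exact_mod_cast hm
  have hstep1 : 6 ^ (q + 2) * ENNReal.ofReal ((m : ℝ)⁻¹ ^ ε) ≤ ENNReal.ofReal (1 / 2) := by
    calc _ ≤ 6 ^ (6 : ℝ) * ENNReal.ofReal ((m : ℝ)⁻¹ ^ ε) := by
          gcongr
          · norm_num
          · linarith
      _ = ENNReal.ofReal (6 ^ 6 * (m : ℝ)⁻¹ ^ ε) := by
          rw [ENNReal.ofReal_mul (by positivity), ENNReal.ofReal_pow (by norm_num),
            ENNReal.rpow_ofNat, ENNReal.ofReal_ofNat]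
      _ ≤ _ := by
          refine ENNReal.ofReal_le_ofReal ?_
          rw [hpow]
          have h5 : Real.exp (-(ε * Real.log m)) ≤ Real.exp (-12) := Real.exp_le_exp.2 (by linarith)
          have h6 : (2.7 : ℝ) ^ 12 ≤ Real.exp 12 := by
            rw [show (12 : ℝ) = ((12 : ℕ) : ℝ) by norm_num, ← Real.exp_one_pow]
            gcongr
            linarith [Real.exp_one_gt_d9]
          have h7 : Real.exp (-12) ≤ (2.7 ^ 12)⁻¹ := by
            rw [Real.exp_neg]
            gcongr
          calc (6 : ℝ) ^ 6 * Real.exp (-(ε * Real.log m)) ≤ 6 ^ 6 * (2.7 ^ 12)⁻¹ := by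
                gcongr
                exact h5.trans h7
            _ ≤ 1 / 2 := by norm_num
  have hstep2 : (2 * (m + 1 : ℕ)) ^ (q + 2) * ((m + 1 : ℕ) : ℝ≥0∞) ^ 2 *
      (((3 * m + 1 : ℕ) : ℝ≥0∞) ^ q * ((D * ENNReal.ofReal (Real.exp (2 * Real.pi)) ^ (q + 2)) ^
        (n + 1) * ENNReal.ofReal ((m : ℝ)⁻¹ ^ (ε * (4 / q) ^ n)))) ≤ ENNReal.ofReal (1 / 2) := by
    have hF : D * ENNReal.ofReal (Real.exp (2 * Real.pi)) ^ (q + 2) ≤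
        ENNReal.ofReal (Real.exp (κ + 12 * Real.pi)) := by
      rw [Real.exp_add, ENNReal.ofReal_mul (Real.exp_pos _).le,
        ENNReal.ofReal_rpow_of_nonneg (Real.exp_pos _).le (by linarith), ← Real.exp_mul]
      refine mul_le_mul' hDκ (ENNReal.ofReal_le_ofReal (Real.exp_le_exp.2 ?_))
      linarith [mul_le_mul_of_nonneg_left (by linarith : q + 2 ≤ 6) (by positivity :
        0 ≤ 2 * Real.pi)]
    have hc1 : (2 * (m + 1 : ℕ) : ℝ≥0∞) ≤ ((4 * m : ℕ) : ℝ≥0∞) := by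
      exact_mod_cast (by omega : 2 * (m + 1) ≤ 4 * m)
    have hc2 : ((m + 1 : ℕ) : ℝ≥0∞) ≤ ((2 * m : ℕ) : ℝ≥0∞) := by
      exact_mod_cast (by omega : m + 1 ≤ 2 * m)
    have hc3 : ((3 * m + 1 : ℕ) : ℝ≥0∞) ≤ ((4 * m : ℕ) : ℝ≥0∞) := by
      exact_mod_cast (by omega : 3 * m + 1 ≤ 4 * m)
    have hc4 : (1 : ℝ≥0∞) ≤ ((4 * m : ℕ) : ℝ≥0∞) := by
      exact_mod_cast (by omega : 1 ≤ 4 * m)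
    calc _ ≤ ((4 * m : ℕ) : ℝ≥0∞) ^ (6 : ℝ) * ((2 * m : ℕ) : ℝ≥0∞) ^ 2 *
          (((4 * m : ℕ) : ℝ≥0∞) ^ (4 : ℝ) * (ENNReal.ofReal (Real.exp (κ + 12 * Real.pi)) ^
          (n + 1) * ENNReal.ofReal ((m : ℝ)⁻¹ ^ (ε * (4 / q) ^ n)))) := by
          have hq0 : 0 ≤ q + 2 := by linarith
          refine mul_le_mul' (mul_le_mul' ?_ (by gcongr)) (mul_le_mul' ?_ (by gcongr))
          · exact (ENNReal.rpow_le_rpow hc1 hq0).trans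
              (ENNReal.rpow_le_rpow_of_exponent_le hc4 (by linarith))
          · exact (ENNReal.rpow_le_rpow hc3 (by linarith)).trans
              (ENNReal.rpow_le_rpow_of_exponent_le hc4 hq4.le)
      _ = ENNReal.ofReal ((4 * m) ^ 6 * (2 * m) ^ 2 * ((4 * m) ^ 4 *
          (Real.exp (κ + 12 * Real.pi) ^ (n + 1) * (m : ℝ)⁻¹ ^ (ε * (4 / q) ^ n)))) := by
          rw [ENNReal.ofReal_mul (by positivity), ENNReal.ofReal_mul (by positivity),
            ENNReal.ofReal_mul (by positivity), ENNReal.ofReal_mul (by positivity),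
            ENNReal.ofReal_pow (by positivity), ENNReal.ofReal_pow (by positivity),
            ENNReal.ofReal_pow (by positivity), ENNReal.ofReal_pow (by positivity),
            show (4 * m : ℝ) = ((4 * m : ℕ) : ℝ) by push_cast; rfl,
            show (2 * m : ℝ) = ((2 * m : ℕ) : ℝ) by push_cast; rfl,
            ENNReal.ofReal_natCast, ENNReal.ofReal_natCast, ENNReal.rpow_ofNat, ENNReal.rpow_ofNat]
      _ ≤ _ := by
          refine ENNReal.ofReal_le_ofReal ?_
          have h5 := two_pow_le_exp 23
          have h6 : (2 : ℝ) ^ 23 * m ^ 12 * (Real.exp (κ + 12 * Real.pi) ^ (n + 1) *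
              (m : ℝ)⁻¹ ^ (ε * (4 / q) ^ n)) ≤ 1 := by
            calc _ ≤ Real.exp (23 : ℕ) * Real.exp (Real.log m) ^ 12 *
                  (Real.exp (κ + 12 * Real.pi) ^ (n + 1) * (m : ℝ)⁻¹ ^ (ε * (4 / q) ^ n)) := by
                  rw [← hexp]
                  gcongr
              _ = Real.exp (23 + 12 * Real.log m + (κ + 12 * Real.pi) * (n + 1) -
                  ε * (4 / q) ^ n * Real.log m) := by
                  rw [hpow, ← Real.exp_nat_mul, ← Real.exp_nat_mul, ← Real.exp_add,
                    ← Real.exp_add, ← Real.exp_add]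
                  push_cast
                  congr 1
                  ring
              _ ≤ 1 := Real.exp_le_one_iff.2 (by linarith)
          linear_combination (1 / 2) * h6
  have hbase : ((3 * m ^ (2 ^ n + 1) + 1 : ℕ) : ℝ≥0∞) ^ (3 : ℝ) * μ Set.univ ≤
      ENNReal.ofReal (Real.exp ((24 + κ) * W)) := by
    calc _ ≤ ((4 * m ^ (2 ^ n + 1) : ℕ) : ℝ≥0∞) ^ (3 : ℝ) * ENNReal.ofReal (Real.exp κ) := by
          gcongr
          have := Nat.one_le_pow (2 ^ n + 1) m (by omega)
          omega
      _ = ENNReal.ofReal ((4 * m ^ (2 ^ n + 1)) ^ 3 * Real.exp κ) := by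
          rw [ENNReal.ofReal_mul (by positivity), ENNReal.ofReal_pow (by positivity),
            show (4 * m ^ (2 ^ n + 1) : ℝ) = ((4 * m ^ (2 ^ n + 1) : ℕ) : ℝ) by push_cast; rfl,
            ENNReal.ofReal_natCast, ENNReal.rpow_ofNat]
      _ ≤ _ := by
          refine ENNReal.ofReal_le_ofReal ?_
          have h5 := two_pow_le_exp 2
          calc ((4 : ℝ) * m ^ (2 ^ n + 1)) ^ 3 * Real.exp κ
              ≤ (Real.exp (2 : ℕ) * Real.exp (Real.log m) ^ (2 ^ n + 1)) ^ 3 * Real.exp κ := by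
                rw [← hexp]
                gcongr
                linarith
            _ = Real.exp (3 * (2 + (2 ^ n + 1) * Real.log m) + κ) := by
                rw [← Real.exp_nat_mul, ← Real.exp_add, ← Real.exp_nat_mul, ← Real.exp_add]
                push_cast
                rfl
            _ ≤ _ := Real.exp_le_exp.2 (by nlinarith)
  have hstep := add_le_add hstep1 hstep2
  rw [← ENNReal.ofReal_add (by norm_num) (by norm_num), add_halves, ENNReal.ofReal_one] at hstep
  refine (LinBound.of_scales hq hq4.le hδ (Real.exp_pos _).le hε hD hdiam hsep hμ hm hstep hbase
    hδ2).mono (ENNReal.ofReal_le_ofReal ?_)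
  rw [Real.rpow_def_of_pos (by positivity), ← Real.exp_add, ← hΛ]
  refine Real.exp_le_exp.2 ?_
  linear_combination h3

/-- A finite measure with polynomial tails at scale `L` around `c`. -/
noncomputable def tailMeasure (c : ℝ × ℝ) (L : ℝ) : Measure (ℝ × ℝ) :=
  volume.withDensity fun z => ENNReal.ofReal ((L ^ 2)⁻¹ * (1 + ‖z - c‖ / L) ^ (-3 : ℝ))

lemma measurable_tailDensity (c : ℝ × ℝ) (L : ℝ) :
    Measurable fun z => ENNReal.ofReal ((L ^ 2)⁻¹ * (1 + ‖z - c‖ / L) ^ (-3 : ℝ)) := by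
  fun_prop

lemma tailMeasure_univ (c : ℝ × ℝ) {L : ℝ} (hL : 0 < L) :
    tailMeasure c L Set.univ = ∫⁻ z : ℝ × ℝ, ENNReal.ofReal ((1 + ‖z‖) ^ (-3 : ℝ)) := by
  have hm : Measurable fun z : ℝ × ℝ => ENNReal.ofReal ((1 + ‖z‖) ^ (-3 : ℝ)) := by fun_prop
  rw [tailMeasure, withDensity_apply _ MeasurableSet.univ, setLIntegral_univ,
    lintegral_sub_right_eq_self
      (fun z : ℝ × ℝ => ENNReal.ofReal ((L ^ 2)⁻¹ * (1 + ‖z‖ / L) ^ (-3 : ℝ))) c]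
  have h := lintegral_map hm (measurable_const_smul L⁻¹) (μ := (volume : Measure (ℝ × ℝ)))
  rw [Measure.map_addHaar_smul _ (inv_ne_zero hL.ne'), lintegral_smul_measure] at h
  have hr : Module.finrank ℝ (ℝ × ℝ) = 2 := by simp
  rw [hr, abs_of_nonneg (by positivity), inv_pow, inv_inv, smul_eq_mul] at h
  have e : ∀ z : ℝ × ℝ, ENNReal.ofReal ((L ^ 2)⁻¹ * (1 + ‖z‖ / L) ^ (-3 : ℝ)) =
      ENNReal.ofReal (L ^ 2)⁻¹ * ENNReal.ofReal ((1 + ‖L⁻¹ • z‖) ^ (-3 : ℝ)) := by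
    intro z
    rw [← ENNReal.ofReal_mul (by positivity), norm_smul, Real.norm_of_nonneg (by positivity),
      inv_mul_eq_div L]
  simp_rw [e]
  rw [lintegral_const_mul _ (by fun_prop), ← h, ← mul_assoc,
    ← ENNReal.ofReal_mul (by positivity), inv_mul_cancel₀ (by positivity), ENNReal.ofReal_one,
    one_mul]

lemma one_add_rpow_le {x y : ℝ} (hx : 0 ≤ x) (hy : 0 ≤ y) (h : y ≤ x + 1) :
    (1 + x) ^ (-3 : ℝ) ≤ 8 * (1 + y) ^ (-3 : ℝ) := by
  rw [Real.rpow_neg (by positivity), Real.rpow_neg (by positivity),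
    ← div_eq_mul_inv, inv_eq_one_div, div_le_div_iff₀ (by positivity) (by positivity), one_mul,
    show (8 : ℝ) = 2 ^ (3 : ℝ) by norm_num, ← Real.mul_rpow (by norm_num) (by positivity)]
  gcongr
  linarith

lemma almostInvariant_tailMeasure (c : ℝ × ℝ) {L : ℝ} (hL : 0 < L) :
    AlmostInvariant (tailMeasure c L) L 8 := by
  intro v hv g hg
  have hgv : Measurable fun z => g (z + v) := hg.comp (measurable_add_const v)
  rw [tailMeasure, lintegral_withDensity_eq_lintegral_mul _ (measurable_tailDensity c L) hg,
    lintegral_withDensity_eq_lintegral_mul _ (measurable_tailDensity c L) hgv,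
    ← lintegral_const_mul _ ((measurable_tailDensity c L).mul hgv),
    ← lintegral_add_right_eq_self _ v]
  refine lintegral_mono fun z => ?_
  simp only [Pi.mul_apply]
  rw [← mul_assoc]
  gcongr
  rw [show (8 : ℝ≥0∞) = ENNReal.ofReal 8 by norm_num, ← ENNReal.ofReal_mul (by norm_num)]
  refine ENNReal.ofReal_le_ofReal ?_
  rw [mul_left_comm]
  gcongr
  refine one_add_rpow_le (by positivity) (by positivity) ?_
  rw [div_add_one hL.ne']
  gcongr
  calc ‖z - c‖ = ‖(z + v - c) - v‖ := by congr 1; abel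
    _ ≤ ‖z + v - c‖ + ‖v‖ := norm_sub_le _ _
    _ ≤ _ := by gcongr

lemma setLIntegral_sqr_le (c : ℝ × ℝ) {L : ℝ} (hL : 0 < L) {g : ℝ × ℝ → ℝ≥0∞}
    (hg : Measurable g) :
    ENNReal.ofReal (L ^ 2)⁻¹ * ∫⁻ z in sqr c L, g z ≤ 8 * ∫⁻ z, g z ∂tailMeasure c L := by
  rw [tailMeasure, lintegral_withDensity_eq_lintegral_mul _ (measurable_tailDensity c L) hg,
    ← lintegral_const_mul _ hg,
    ← lintegral_const_mul _ ((measurable_tailDensity c L).mul hg)]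
  have hms : MeasurableSet (sqr c L) := measurableSet_Icc.prod measurableSet_Icc
  refine (setLIntegral_mono ((((measurable_tailDensity c L).mul hg)).const_mul _) ?_).trans
    (setLIntegral_le_lintegral _ _)
  intro z hz
  simp only [Pi.mul_apply]
  rw [← mul_assoc]
  gcongr
  rw [show (8 : ℝ≥0∞) = ENNReal.ofReal 8 by norm_num, ← ENNReal.ofReal_mul (by norm_num)]
  refine ENNReal.ofReal_le_ofReal ?_
  rw [mul_left_comm]
  refine le_mul_of_one_le_right (by positivity) ?_
  have h := one_add_rpow_le (x := 0) (y := ‖z - c‖ / L) le_rfl (by positivity) ?_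
  · simpa using h
  · rw [zero_add, div_le_one hL, Prod.norm_def]
    obtain ⟨⟨h1, h2⟩, h3, h4⟩ := hz
    refine max_le (abs_le.2 ⟨?_, ?_⟩) (abs_le.2 ⟨?_, ?_⟩) <;>
      simp only [Prod.fst_sub, Prod.snd_sub] <;> linarith

lemma lintegral_expSum_one_le {Θ : Finset ℝ} {μ : Measure (ℝ × ℝ)} {p : ℝ} {K : ℝ≥0∞} (hp : 1 ≤ p)
    (hΘ : ∀ θ ∈ Θ, -Real.pi < θ ∧ θ ≤ Real.pi)
    (h : ∀ Θ' ⊆ Θ, (∀ θ ∈ Θ', ∀ φ ∈ Θ', |θ - φ| ≤ 1) → LinBound Θ' μ p 1 K) :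
    ∫⁻ z, ‖expSum Θ 1 z‖ₑ ^ p ∂μ ≤ 7 ^ p * K * (Θ.card : ℝ≥0∞) ^ (p / 2) := by
  set f : ℝ → ℕ := fun θ => ⌊θ + Real.pi⌋₊ with hf
  have hfloor : ∀ i, ∀ θ ∈ Θ.filter fun θ => f θ = i,
      -Real.pi + i ≤ θ ∧ θ ≤ -Real.pi + i + 1 := by
    intro i θ hθ
    obtain ⟨h1, h2⟩ := Finset.mem_filter.1 hθ
    have h3 := (Nat.floor_eq_iff (by linarith [(hΘ θ h1).1])).1 h2
    constructor <;> linarith [h3.1, h3.2]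
  have hmaps : ∀ θ ∈ Θ, f θ ∈ Finset.range 7 := by
    intro θ hθ
    rw [Finset.mem_range, Nat.floor_lt (by linarith [(hΘ θ hθ).1])]
    push_cast
    linarith [(hΘ θ hθ).2, Real.pi_lt_d2]
  have hsum : ∀ z, expSum Θ 1 z = ∑ i ∈ Finset.range 7, expSum (Θ.filter fun θ => f θ = i) 1 z :=
    fun z => (Finset.sum_fiberwise_of_maps_to hmaps _).symm
  have hpt : ∀ z, ‖expSum Θ 1 z‖ₑ ^ p ≤
      7 ^ (p - 1) * ∑ i ∈ Finset.range 7, ‖expSum (Θ.filter fun θ => f θ = i) 1 z‖ₑ ^ p := by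
    intro z
    have := ENNReal.rpow_sum_le_const_mul_sum_rpow (Finset.range 7)
      (fun i => ‖expSum (Θ.filter fun θ => f θ = i) 1 z‖ₑ) hp
    rw [Finset.card_range] at this
    refine le_trans ?_ this
    rw [hsum]
    gcongr
    exact enorm_sum_le _ _
  have hm : ∀ i, Measurable fun z => ‖expSum (Θ.filter fun θ => f θ = i) 1 z‖ₑ ^ p := fun i =>
    (continuous_expSum _ 1).measurable.enorm.pow_const _
  calc ∫⁻ z, ‖expSum Θ 1 z‖ₑ ^ p ∂μ
      ≤ ∫⁻ z, 7 ^ (p - 1) * ∑ i ∈ Finset.range 7,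
          ‖expSum (Θ.filter fun θ => f θ = i) 1 z‖ₑ ^ p ∂μ := lintegral_mono hpt
    _ = 7 ^ (p - 1) * ∑ i ∈ Finset.range 7,
          ∫⁻ z, ‖expSum (Θ.filter fun θ => f θ = i) 1 z‖ₑ ^ p ∂μ := by
        rw [lintegral_const_mul _ (Finset.measurable_fun_sum _ fun i _ => hm i),
          lintegral_finsetSum _ fun i _ => hm i]
    _ ≤ 7 ^ (p - 1) * ∑ i ∈ Finset.range 7, K * (Θ.card : ℝ≥0∞) ^ (p / 2) := by
        gcongr with i
        refine (h _ (Finset.filter_subset _ _) ?_ (-Real.pi + i) 1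
          fun θ hθ _ => hfloor i θ hθ).trans ?_
        · intro θ hθ φ hφ
          have h1 := hfloor i θ hθ
          have h2 := hfloor i φ hφ
          rw [abs_le]
          constructor <;> linarith
        · have : 0 ≤ p / 2 := by linarith
          gcongr
          rw [energy]
          simpa using Finset.card_le_card (Finset.filter_subset _ _)
    _ = 7 ^ (p - 1) * 7 ^ (1 : ℝ) * (K * (Θ.card : ℝ≥0∞) ^ (p / 2)) := by
        rw [Finset.sum_const, Finset.card_range, nsmul_eq_mul, ENNReal.rpow_one]
        push_cast
        ring
    _ = _ := by
        rw [← ENNReal.rpow_add_of_nonneg _ _ (by linarith) (by norm_num), sub_add_cancel, mul_assoc]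

lemma exists_angles {A : Finset (ℝ × ℝ)} {δ : ℝ} (hA : ∀ a ∈ A, a.1 ^ 2 + a.2 ^ 2 = 1)
    (hsep : ∀ a ∈ A, ∀ a' ∈ A, a ≠ a' → δ ≤ Real.sqrt ((a.1 - a'.1) ^ 2 + (a.2 - a'.2) ^ 2)) :
    ∃ Θ : Finset ℝ, Θ.card = A.card ∧ (∀ θ ∈ Θ, -Real.pi < θ ∧ θ ≤ Real.pi) ∧
      (∀ θ ∈ Θ, ∀ φ ∈ Θ, θ ≠ φ → δ ≤ |θ - φ|) ∧
      ∀ z : ℝ × ℝ, ∑ a ∈ A, Complex.exp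
        (2 * Real.pi * Complex.I * ((a.1 * z.1 + a.2 * z.2 : ℝ) : ℂ)) = expSum Θ 1 z := by
  set t : ℝ × ℝ → ℝ := fun a => Complex.arg ⟨a.1, a.2⟩ with ht
  have hcs : ∀ a ∈ A, a = (Real.cos (t a), Real.sin (t a)) := by
    intro a ha
    have hn : ‖(⟨a.1, a.2⟩ : ℂ)‖ = 1 := by
      rw [Complex.norm_def, Complex.normSq_mk, ← sq, ← sq, hA a ha, Real.sqrt_one]
    have h0 : (⟨a.1, a.2⟩ : ℂ) ≠ 0 := norm_ne_zero_iff.1 (by rw [hn]; exact one_ne_zero)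
    rw [ht, Complex.cos_arg h0, Complex.sin_arg, hn]
    simp
  have hinj : Set.InjOn t A := by
    intro a ha b hb h
    rw [hcs a ha, hcs b hb, h]
  refine ⟨A.image t, Finset.card_image_of_injOn hinj, ?_, ?_, ?_⟩
  · intro θ hθ
    obtain ⟨a, _, rfl⟩ := Finset.mem_image.1 hθ
    exact ⟨Complex.neg_pi_lt_arg _, Complex.arg_le_pi _⟩
  · intro θ hθ φ hφ hne
    obtain ⟨a, ha, rfl⟩ := Finset.mem_image.1 hθ
    obtain ⟨b, hb, rfl⟩ := Finset.mem_image.1 hφ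
    refine (hsep a ha b hb fun h => hne (h ▸ rfl)).trans ?_
    rw [← Real.sqrt_sq_eq_abs]
    refine Real.sqrt_le_sqrt ?_
    have h1 := Real.one_sub_sq_div_two_le_cos (x := t a - t b)
    rw [Real.cos_sub] at h1
    have ea := hcs a ha
    have eb := hcs b hb
    rw [congrArg Prod.fst ea, congrArg Prod.snd ea, congrArg Prod.fst eb, congrArg Prod.snd eb]
    nlinarith [Real.sin_sq_add_cos_sq (t a), Real.sin_sq_add_cos_sq (t b)]
  · intro z
    rw [expSum, Finset.sum_image hinj]
    refine Finset.sum_congr rfl fun a ha => ?_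
    rw [Pi.one_apply, one_mul, wave]
    nth_rw 1 [congrArg Prod.fst (hcs a ha)]
    nth_rw 1 [congrArg Prod.snd (hcs a ha)]

lemma exists_tail_bound : ∃ κ : ℝ, 0 ≤ κ ∧ (8 : ℝ≥0∞) ≤ ENNReal.ofReal (Real.exp κ) ∧
    ∫⁻ z : ℝ × ℝ, ENNReal.ofReal ((1 + ‖z‖) ^ (-3 : ℝ)) ≤ ENNReal.ofReal (Real.exp κ) := by
  have hfin : ∫⁻ z : ℝ × ℝ, ENNReal.ofReal ((1 + ‖z‖) ^ (-3 : ℝ)) < ⊤ :=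
    finite_integral_one_add_norm (by simp; norm_num)
  set I := ∫⁻ z : ℝ × ℝ, ENNReal.ofReal ((1 + ‖z‖) ^ (-3 : ℝ)) with hI
  have h := Real.add_one_le_exp (8 + I.toReal)
  have h0 : 0 ≤ I.toReal := ENNReal.toReal_nonneg
  refine ⟨8 + I.toReal, by positivity, ?_, ?_⟩
  · rw [show (8 : ℝ≥0∞) = ENNReal.ofReal 8 by norm_num]
    exact ENNReal.ofReal_le_ofReal (by linarith)
  · exact (ENNReal.ofReal_toReal hfin.ne).symm.le.trans
      (ENNReal.ofReal_le_ofReal (by linarith))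

lemma seven_le_exp_two : (7 : ℝ) ≤ Real.exp 2 := by
  have h := Real.exp_one_gt_d9
  rw [show (2 : ℝ) = 1 + 1 by norm_num, Real.exp_add]
  nlinarith

/-- The `p`-th moment over a square of side `L ≥ δ⁻²`. -/
lemma average_expSum_le {Θ : Finset ℝ} {p δ κ L : ℝ} (hp : 4 < p) (hp6 : p < 6) (hδ : 0 < δ)
    (hδ1 : 1 ≤ Real.log (1 / δ)) (hL : 1 / δ ^ 2 ≤ L) (hκ : 0 ≤ κ)
    (hκ8 : (8 : ℝ≥0∞) ≤ ENNReal.ofReal (Real.exp κ))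
    (hκI : ∫⁻ z : ℝ × ℝ, ENNReal.ofReal ((1 + ‖z‖) ^ (-3 : ℝ)) ≤ ENNReal.ofReal (Real.exp κ))
    (hΘ : ∀ θ ∈ Θ, -Real.pi < θ ∧ θ ≤ Real.pi)
    (hsep : ∀ θ ∈ Θ, ∀ φ ∈ Θ, θ ≠ φ → δ ≤ |θ - φ|) (c : ℝ × ℝ) :
    (L ^ 2)⁻¹ * ∫ z in sqr c L, ‖expSum Θ 1 z‖ ^ p ≤
      Real.exp ((86 + 3 * κ + 24 * Real.pi) *
        Real.log (1 / δ) ^ (1 - 1 / 4 * (1 - Real.logb 2 ((p - 2) / 2)))) *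
      (Θ.card : ℝ) ^ (p / 2) := by
  have hL0 : 0 < L := lt_of_lt_of_le (by positivity) hL
  set W := Real.log (1 / δ) ^ (1 - 1 / 4 * (1 - Real.logb 2 ((p - 2) / 2))) with hW
  have hW1 : 1 ≤ W := by
    refine Real.one_le_rpow hδ1 ?_
    have := Real.logb_nonneg (b := 2) (x := (p - 2) / 2) (by norm_num) (by linarith)
    linarith
  set K := Real.exp ((71 + 3 * κ + 24 * Real.pi) * W) with hK
  have hlin : ∀ Θ' ⊆ Θ, (∀ θ ∈ Θ', ∀ φ ∈ Θ', |θ - φ| ≤ 1) →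
      LinBound Θ' (tailMeasure c L) p 1 (ENNReal.ofReal K) := by
    intro Θ' hΘ' hdiam
    have := linBound_one (q := p - 2) (μ := tailMeasure c L) (by linarith) (by linarith) hδ hδ1 hκ
      (by norm_num) hκ8 (by rwa [tailMeasure_univ c hL0]) hdiam
      (fun θ hθ φ hφ => hsep θ (hΘ' hθ) φ (hΘ' hφ))
      ((almostInvariant_tailMeasure c hL0).mono hL)
    rwa [sub_add_cancel] at this
  have hmain := (setLIntegral_sqr_le c hL0
    ((continuous_expSum Θ 1).measurable.enorm.pow_const p)).trans
    (mul_le_mul_right (lintegral_expSum_one_le (by linarith) hΘ hlin) 8)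
  rw [integral_eq_lintegral_of_nonneg_ae (Filter.Eventually.of_forall fun z => by positivity)
    ((continuous_expSum Θ 1).norm.rpow_const fun _ => Or.inr (by linarith)).aestronglyMeasurable]
  have e : ∀ z, ENNReal.ofReal (‖expSum Θ 1 z‖ ^ p) = ‖expSum Θ 1 z‖ₑ ^ p := by
    intro z
    rw [← ENNReal.ofReal_rpow_of_nonneg (norm_nonneg _) (by linarith), ofReal_norm]
  simp_rw [e]
  rw [← ENNReal.toReal_ofReal (show 0 ≤ (L ^ 2)⁻¹ by positivity), ← ENNReal.toReal_mul]
  refine ENNReal.toReal_le_of_le_ofReal (by positivity) (hmain.trans ?_)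
  calc 8 * (7 ^ p * ENNReal.ofReal K * (Θ.card : ℝ≥0∞) ^ (p / 2))
      = ENNReal.ofReal (8 * (7 ^ p * K * (Θ.card : ℝ) ^ (p / 2))) := by
        rw [ENNReal.ofReal_mul (by norm_num), ENNReal.ofReal_mul (by positivity),
          ENNReal.ofReal_mul (by positivity), ← ENNReal.ofReal_rpow_of_nonneg (by norm_num)
          (by linarith), ← ENNReal.ofReal_rpow_of_nonneg (by positivity) (by linarith)]
        norm_num
    _ ≤ _ := by
        refine ENNReal.ofReal_le_ofReal ?_
        have h8 : (8 : ℝ) ≤ Real.exp 3 := by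
          have := two_pow_le_exp 3
          norm_num at this ⊢
          exact this
        have h7 : (7 : ℝ) ^ p ≤ Real.exp 12 := by
          calc (7 : ℝ) ^ p ≤ Real.exp 2 ^ p := by
                gcongr
                exact seven_le_exp_two
            _ = Real.exp (2 * p) := (Real.exp_mul _ _).symm
            _ ≤ _ := Real.exp_le_exp.2 (by linarith)
        calc _ ≤ Real.exp 3 * (Real.exp 12 * K * (Θ.card : ℝ) ^ (p / 2)) := by gcongr
          _ = Real.exp (15 + (71 + 3 * κ + 24 * Real.pi) * W) * (Θ.card : ℝ) ^ (p / 2) := by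
              rw [hK, ← Real.exp_add, ← mul_assoc, ← Real.exp_add]
              ring_nf
          _ ≤ _ := by
              gcongr
              linarith

end CircleExpSum

/-- Square root cancellation for exponential sums over the circle: for every
small enough `δ` there is a scale `L` with `δ⁻³ ≤ L ≤ δ⁻³ exp(C (log(1/δ))^{log₃ 2})` such that
for every `4 < p < 6`, every `δ`-separated finite set `A ⊂ S¹`, and every axis-parallel square
`B` of side `L`,
`‖Σ_{a ∈ A} e^{2πi a·z}‖_{L^p_#(B)} ≤ exp(C (log(1/δ))^{1-σ_p} (log log(1/δ))^C) |A|^{1/2}`,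
where `σ_p = (1/4)(1 - log₂((p-2)/2))`. -/
theorem sqrt_cancellation_circle :
    ∃ C : ℝ, 0 < C ∧ ∃ δ₀ : ℝ, 0 < δ₀ ∧ ∀ δ : ℝ, 0 < δ → δ < δ₀ →
      ∃ L : ℝ, δ ^ (-3 : ℤ) ≤ L ∧
        L ≤ δ ^ (-3 : ℤ) * Real.exp (C * Real.log (1 / δ) ^ Real.logb 3 2) ∧
        ∀ p : ℝ, 4 < p → p < 6 → ∀ A : Finset (ℝ × ℝ),
          (∀ a ∈ A, a.1 ^ 2 + a.2 ^ 2 = 1) →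
          (∀ a ∈ A, ∀ a' ∈ A, a ≠ a' →
            δ ≤ Real.sqrt ((a.1 - a'.1) ^ 2 + (a.2 - a'.2) ^ 2)) →
          ∀ c : ℝ × ℝ,
            ((L ^ 2)⁻¹ * ∫ z in sqr c L,
                ‖∑ a ∈ A, Complex.exp
                    (2 * Real.pi * Complex.I * ((a.1 * z.1 + a.2 * z.2 : ℝ) : ℂ))‖ ^ p) ^ (1 / p)
              ≤ Real.exp (C * Real.log (1 / δ) ^ (1 - (1 / 4) * (1 - Real.logb 2 ((p - 2) / 2))) *
                    Real.log (Real.log (1 / δ)) ^ C) *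
                  (A.card : ℝ) ^ (1 / 2 : ℝ) := by
  obtain ⟨κ, hκ, hκ8, hκI⟩ := CircleExpSum.exists_tail_bound
  have hpi := Real.pi_pos
  refine ⟨86 + 3 * κ + 24 * Real.pi, by positivity, Real.exp (-Real.exp 1), Real.exp_pos _,
    fun δ hδ hδ₀ => ?_⟩
  have hlog : Real.exp 1 ≤ Real.log (1 / δ) := by
    rw [Real.le_log_iff_exp_le (by positivity), one_div, ← neg_neg (Real.exp 1), Real.exp_neg]
    gcongr
  have hlog1 : 1 ≤ Real.log (1 / δ) := by linarith [Real.add_one_le_exp (1 : ℝ)]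
  have hloglog : 1 ≤ Real.log (Real.log (1 / δ)) :=
    (Real.le_log_iff_exp_le (by linarith)).2 hlog
  have hδ1 : δ ≤ 1 := hδ₀.le.trans (Real.exp_le_one_iff.2 (by linarith [Real.exp_pos 1]))
  refine ⟨δ ^ (-3 : ℤ), le_rfl, ?_, fun p hp hp6 A hA hsep c => ?_⟩
  · exact le_mul_of_one_le_right (by positivity) (Real.one_le_exp (by positivity))
  have hL : 1 / δ ^ 2 ≤ δ ^ (-3 : ℤ) := by
    rw [zpow_neg, one_div]
    gcongr
    exact_mod_cast pow_le_pow_of_le_one hδ.le hδ1 (by norm_num : 2 ≤ 3)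
  obtain ⟨Θ, hcard, hΘ, hΘsep, hsum⟩ := CircleExpSum.exists_angles hA hsep
  simp_rw [hsum]
  have h := CircleExpSum.average_expSum_le hp hp6 hδ hlog1 hL hκ hκ8 hκI hΘ hΘsep c
  set W := Real.log (1 / δ) ^ (1 - 1 / 4 * (1 - Real.logb 2 ((p - 2) / 2)))
  have hW : 0 ≤ W := by positivity
  set C := 86 + 3 * κ + 24 * Real.pi
  have hC : 0 ≤ C := by positivity
  have hp0 : 0 < p := by linarith
  calc _ ≤ (Real.exp (C * W) * (Θ.card : ℝ) ^ (p / 2)) ^ (1 / p) := by gcongr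
    _ = Real.exp (C * W * (1 / p)) * (A.card : ℝ) ^ (1 / 2 : ℝ) := by
        rw [Real.mul_rpow (by positivity) (by positivity), ← Real.exp_mul, ← Real.rpow_mul
          (by positivity), hcard]
        congr 2
        field_simp
    _ ≤ _ := by
        refine mul_le_mul_of_nonneg_right (Real.exp_le_exp.2 ?_) (by positivity)
        have h1 : 1 / p ≤ 1 := (div_le_one hp0).2 (by linarith)
        have h2 := Real.one_le_rpow hloglog hC
        exact mul_le_mul_of_nonneg_left (h1.trans h2) (by positivity)
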